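/- arXiv:1610.01583 — 2 statements merged into one kernel-verified Lean document; each statement's English description precedes it below -/
import Mathlib

section
/- The Riemann Hypothesis is true if and only if η(s) → 1 as Re(s) → +∞ (uniformly in Im(s)). -/
open Complex Filter Topology

/-- `h(s) = (1/2) ∏_ν (1 - (s - s²)/|s_ν|²)`. -/
noncomputable def hfun (sν : ℕ → ℂ) (s : ℂ) : ℂ :=
  (1 / 2 : ℂ) * ∏' ν : ℕ, (1 - (s - s ^ 2) / ((‖sν ν‖ : ℂ) ^ 2))

/-- `f` has a zero of exact order `m` at `z`. -/
def ZeroOfOrder (f : ℂ → ℂ) (z : ℂ) (m : ℕ) : Prop :=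
  ∃ g : ℂ → ℂ, AnalyticAt ℂ g z ∧ g z ≠ 0 ∧
    ∀ᶠ w in 𝓝[≠] z, f w = (w - z) ^ m * g w

/-- `sν` enumerates, counted with multiplicity, the zeros of `f` with `Re = 1/2`, `Im > 0`. -/
def CriticalZeroEnumFor (f : ℂ → ℂ) (sν : ℕ → ℂ) : Prop :=
  (∀ ν, (sν ν).re = 1 / 2 ∧ 0 < (sν ν).im ∧ f (sν ν) = 0) ∧
  ∀ z : ℂ, z.re = 1 / 2 → 0 < z.im → f z = 0 →
    ZeroOfOrder f z (Nat.card {ν : ℕ // sν ν = z})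

/-- `η`, defined by `h(s) = (s/2)(s-1)π^{-s/2}Γ(s/2)η(s)`. -/
noncomputable def etaFun (sν : ℕ → ℂ) (s : ℂ) : ℂ :=
  hfun sν s / (s / 2 * (s - 1) * (Real.pi : ℂ) ^ (-s / 2) * Complex.Gamma (s / 2))

open MeasureTheory Set in
lemma norm_mellin_le_add {f : ℝ → ℂ} {ρ : ℝ → ℝ} (hf : ∀ t, 0 < t → f t = ρ t)
    (hρ : ∀ t, 0 < t → 0 ≤ ρ t) {a b : ℝ} {s : ℂ} (ha : MellinConvergent f a)
    (hb : MellinConvergent f b) (has : a ≤ s.re) (hsb : s.re ≤ b) :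
    ‖mellin f s‖ ≤ ‖mellin f a‖ + ‖mellin f b‖ := by
  have key (x t : ℝ) (ht : t ∈ Ioi (0 : ℝ)) :
      (t : ℂ) ^ ((x : ℂ) - 1) • f t = ((t ^ (x - 1) * ρ t : ℝ) : ℂ) := by
    rw [hf t ht, smul_eq_mul, ofReal_mul, ofReal_cpow (le_of_lt ht)]
    push_cast; rfl
  have hmellin (x : ℝ) (hx : MellinConvergent f x) :
      IntegrableOn (fun t : ℝ ↦ t ^ (x - 1) * ρ t) (Ioi 0) := by
    have := (integrableOn_congr_fun (key x) measurableSet_Ioi).mp hx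
    exact (Integrable.re this).congr (.of_forall fun t ↦ by simp)
  have hval (x : ℝ) : ‖mellin f x‖ = ∫ t in Ioi (0 : ℝ), t ^ (x - 1) * ρ t := by
    rw [mellin, setIntegral_congr_fun measurableSet_Ioi (key x), integral_complex_ofReal, norm_real,
      Real.norm_of_nonneg]
    exact setIntegral_nonneg measurableSet_Ioi fun t ht ↦
      mul_nonneg (Real.rpow_nonneg (le_of_lt ht) _) (hρ t ht)
  rw [hval, hval, ← integral_add (hmellin a ha) (hmellin b hb), mellin]
  refine norm_integral_le_of_norm_le ((hmellin a ha).add (hmellin b hb)) ?_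
  refine (ae_restrict_iff' measurableSet_Ioi).mpr (.of_forall fun t ht ↦ ?_)
  have ht0 : 0 < t := ht
  rw [norm_smul, norm_cpow_eq_rpow_re_of_pos ht0, hf t ht0, norm_real,
    Real.norm_of_nonneg (hρ t ht0), ← add_mul]
  refine mul_le_mul_of_nonneg_right ?_ (hρ t ht0)
  rw [sub_re, one_re]
  rcases le_total 1 t with h | h
  · exact (Real.rpow_le_rpow_of_exponent_le h (by linarith)).trans
      (le_add_of_nonneg_left (Real.rpow_nonneg ht0.le _))
  · exact (Real.rpow_le_rpow_of_exponent_ge ht0 h (by linarith)).trans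
      (le_add_of_nonneg_right (Real.rpow_nonneg ht0.le _))

open HurwitzZeta in
lemma one_le_evenKernel_zero {t : ℝ} (ht : 0 < t) : 1 ≤ evenKernel 0 t := by
  have := (hasSum_int_evenKernel₀ 0 ht).nonneg (fun n ↦ by split_ifs <;> positivity)
  simpa using this

open HurwitzZeta Set in
lemma f_modif_hurwitzEvenFEPair_zero {t : ℝ} (ht : 0 < t) : ∃ r : ℝ, 0 ≤ r ∧
    (hurwitzEvenFEPair 0).f_modif t = r := by
  rcases lt_trichotomy t 1 with h | rfl | h
  · refine ⟨evenKernel 0 t - t ^ (-(1 / 2) : ℝ), ?_, ?_⟩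
    · have h1 := one_le_evenKernel_zero (one_div_pos.mpr ht)
      rw [sub_nonneg, evenKernel_functional_equation, ← evenKernel_eq_cosKernel_of_zero,
        Real.rpow_neg ht.le, ← one_div]
      exact le_mul_of_one_le_right (by positivity) h1
    · rw [WeakFEPair.f_modif, Pi.add_apply, indicator_of_notMem (by simp [h.le]),
        indicator_of_mem (mem_Ioo.mpr ⟨ht, h⟩)]
      simp [hurwitzEvenFEPair]
  · exact ⟨0, le_rfl, by simp [WeakFEPair.f_modif]⟩
  · refine ⟨evenKernel 0 t - 1, sub_nonneg.mpr (one_le_evenKernel_zero ht), ?_⟩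
    rw [WeakFEPair.f_modif, Pi.add_apply, indicator_of_mem (mem_Ioi.mpr h),
      indicator_of_notMem (fun h' ↦ lt_asymm h h'.2)]
    simp [hurwitzEvenFEPair]

open HurwitzZeta in
lemma norm_completedRiemannZeta₀_le {s : ℂ} {x : ℝ} (h1 : 1 - x ≤ s.re) (h2 : s.re ≤ x) :
    ‖completedRiemannZeta₀ s‖ ≤ 2 * ‖completedRiemannZeta₀ x‖ := by
  have hconv (z : ℂ) : MellinConvergent (hurwitzEvenFEPair 0).f_modif z :=
    (hurwitzEvenFEPair 0).isStrongFEPair_toStrongFEPair.hasMellin z |>.1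
  choose! ρ hρ using fun (t : ℝ) (ht : 0 < t) ↦ f_modif_hurwitzEvenFEPair_zero ht
  have hdef (z : ℂ) : completedRiemannZeta₀ z = mellin (hurwitzEvenFEPair 0).f_modif (z / 2) / 2 :=
    rfl
  have key := norm_mellin_le_add (fun t ht ↦ (hρ t ht).2) (fun t ht ↦ (hρ t ht).1)
    (hconv (((1 - x) / 2 : ℝ) : ℂ)) (hconv ((x / 2 : ℝ) : ℂ)) (s := s / 2)
    (by simpa using by linarith) (by simpa using by linarith)
  have h3 : ‖completedRiemannZeta₀ s‖ ≤
      ‖completedRiemannZeta₀ (1 - x)‖ + ‖completedRiemannZeta₀ x‖ := by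
    simp only [hdef, norm_div, norm_ofNat]
    push_cast at key
    linarith
  rw [completedRiemannZeta₀_one_sub] at h3
  linarith

lemma norm_riemannZeta_le_two {s : ℂ} (hs : 2 ≤ s.re) : ‖riemannZeta s‖ ≤ 2 := by
  have hsum : Summable fun n : ℕ ↦ ‖1 / (n : ℂ) ^ s‖ :=
    (Complex.summable_one_div_nat_cpow.mpr (by linarith)).norm
  have h2 : HasSum (fun n : ℕ ↦ 1 / (n : ℝ) ^ 2) (Real.pi ^ 2 / 6) := hasSum_zeta_two
  rw [zeta_eq_tsum_one_div_nat_cpow (by linarith)]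
  have hle : ∀ n : ℕ, ‖1 / (n : ℂ) ^ s‖ ≤ 1 / (n : ℝ) ^ 2 := by
    intro n
    rcases Nat.eq_zero_or_pos n with rfl | hn
    · have : s ≠ 0 := by rintro rfl; norm_num at hs
      simp [this]
    · rw [norm_div, norm_one, norm_natCast_cpow_of_pos hn, ← Real.rpow_natCast]
      have h1n : (1 : ℝ) ≤ n := by exact_mod_cast hn
      gcongr
      · exact_mod_cast hs
  calc _ ≤ ∑' n : ℕ, ‖1 / (n : ℂ) ^ s‖ := norm_tsum_le_tsum_norm hsum
    _ ≤ ∑' n : ℕ, 1 / (n : ℝ) ^ 2 := hsum.tsum_le_tsum hle h2.summable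
    _ = Real.pi ^ 2 / 6 := h2.tsum_eq
    _ ≤ 2 := by nlinarith [Real.pi_lt_d2, Real.pi_pos]

lemma norm_completedRiemannZeta₀_two_mul_le {n : ℕ} (hn : 1 ≤ n) :
    ‖completedRiemannZeta₀ (2 * n : ℝ)‖ ≤ (n : ℝ) ^ n + 1 / 2 := by
  have hn' : (1 : ℝ) ≤ n := by exact_mod_cast hn
  have hz : ((2 * n : ℝ) : ℂ) ≠ 0 := by norm_cast; positivity
  have hz1 : (2 * n : ℝ) - 1 ≠ 0 := by linarith
  have hre : (2 : ℝ) ≤ ((2 * n : ℝ) : ℂ).re := by rw [ofReal_re]; linarith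
  have hG : Gammaℝ ((2 * n : ℝ) : ℂ) ≠ 0 := Gammaℝ_ne_zero_of_re_pos (by linarith)
  have h1 : completedRiemannZeta ((2 * n : ℝ) : ℂ) =
      Gammaℝ ((2 * n : ℝ) : ℂ) * riemannZeta ((2 * n : ℝ) : ℂ) := by
    rw [riemannZeta_def_of_ne_zero hz]; field_simp
  have h2 : completedRiemannZeta₀ ((2 * n : ℝ) : ℂ) =
      Gammaℝ ((2 * n : ℝ) : ℂ) * riemannZeta ((2 * n : ℝ) : ℂ) +
        ((1 / (2 * n) - 1 / (2 * n - 1) : ℝ) : ℂ) := by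
    rw [← h1, completedRiemannZeta_eq]
    have : (1 : ℂ) - ((2 * n : ℝ) : ℂ) = - ((2 * n - 1 : ℝ) : ℂ) := by push_cast; ring
    rw [this]; push_cast; rw [one_div_neg_eq_neg_one_div]; ring
  have hGle : ‖Gammaℝ ((2 * n : ℝ) : ℂ)‖ ≤ (n : ℝ) ^ n / 2 := by
    obtain ⟨m, rfl⟩ : ∃ m, n = m + 1 := ⟨n - 1, by omega⟩
    have e1 : ((2 * (m + 1 : ℕ) : ℝ) : ℂ) / 2 = (m : ℂ) + 1 := by push_cast; ring
    rw [Gammaℝ_def, e1, Complex.Gamma_nat_eq_factorial, norm_mul, Complex.norm_natCast,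
      norm_cpow_eq_rpow_re_of_pos Real.pi_pos]
    have e2 : (-((2 * (m + 1 : ℕ) : ℝ) : ℂ) / 2).re = -((m : ℝ) + 1) := by
      rw [neg_div, e1]; simp
    have e3 : Real.pi ^ (-((m : ℝ) + 1)) ≤ 1 / 2 := by
      calc Real.pi ^ (-((m : ℝ) + 1)) ≤ Real.pi ^ (-1 : ℝ) :=
            Real.rpow_le_rpow_of_exponent_le (by linarith [Real.pi_gt_three])
              (by linarith [(Nat.cast_nonneg m : (0 : ℝ) ≤ m)])
        _ ≤ 1 / 2 := by
            rw [Real.rpow_neg_one, ← one_div]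
            exact one_div_le_one_div_of_le (by norm_num) (by linarith [Real.pi_gt_three])
    have e4 : ((m.factorial : ℕ) : ℝ) ≤ ((m + 1 : ℕ) : ℝ) ^ (m + 1) := by
      have := (Nat.factorial_le (Nat.le_succ m)).trans (Nat.factorial_le_pow (m + 1))
      exact_mod_cast this
    rw [e2]
    calc _ ≤ 1 / 2 * (((m + 1 : ℕ) : ℝ) ^ (m + 1)) := by gcongr
      _ = _ := by ring
  have hc : |1 / (2 * n) - 1 / (2 * n - 1 : ℝ)| ≤ 1 / 2 := by
    have a1 : 1 / (2 * n) - 1 / (2 * n - 1 : ℝ) = - (1 / (2 * n * (2 * n - 1))) := by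
      field_simp; ring
    rw [a1, abs_neg, abs_of_nonneg (one_div_nonneg.mpr (by nlinarith))]
    exact one_div_le_one_div_of_le (by norm_num) (by nlinarith)
  rw [h2]
  refine (norm_add_le _ _).trans ?_
  rw [norm_mul, norm_real, Real.norm_eq_abs]
  have := mul_le_mul hGle (norm_riemannZeta_le_two hre) (norm_nonneg _) (by positivity)
  linarith

/-- The Riemann `ξ` function. -/
noncomputable def riemannXi (s : ℂ) : ℂ := (s * (s - 1) * completedRiemannZeta₀ s + 1) / 2

lemma differentiable_riemannXi : Differentiable ℂ riemannXi := by
  have := differentiable_completedZeta₀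
  unfold riemannXi
  fun_prop

lemma riemannXi_one_sub (s : ℂ) : riemannXi (1 - s) = riemannXi s := by
  rw [riemannXi, riemannXi, completedRiemannZeta₀_one_sub]; ring

lemma riemannXi_zero : riemannXi 0 = 1 / 2 := by simp [riemannXi]

lemma riemannXi_eq {s : ℂ} (h0 : s ≠ 0) (h1 : s ≠ 1) :
    riemannXi s = s / 2 * (s - 1) * completedRiemannZeta s := by
  have : 1 - s ≠ 0 := sub_ne_zero.mpr h1.symm
  rw [riemannXi, completedRiemannZeta_eq]; field_simp; ring

lemma riemannXi_half_ne_zero : riemannXi (1 / 2) ≠ 0 := by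
  have h := norm_completedRiemannZeta₀_le (s := 1 / 2) (x := (2 * (1 : ℕ) : ℝ)) (by norm_num)
    (by norm_num)
  have h2 := norm_completedRiemannZeta₀_two_mul_le (n := 1) le_rfl
  intro h0
  have h3 : completedRiemannZeta₀ (1 / 2) = 4 := by
    rw [riemannXi] at h0
    linear_combination (-8) * h0
  rw [h3, norm_ofNat] at h
  norm_num at h2 h
  linarith

lemma riemannXi_one : riemannXi 1 = 1 / 2 := by simp [riemannXi]

lemma riemannXi_eq_mul_riemannZeta {s : ℂ} (h0 : s ≠ 0) (h1 : s ≠ 1) (hG : Gammaℝ s ≠ 0) :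
    riemannXi s = s / 2 * (s - 1) * Gammaℝ s * riemannZeta s := by
  rw [riemannXi_eq h0 h1, riemannZeta_def_of_ne_zero h0]; field_simp

lemma norm_riemannXi_le {s : ℂ} {R : ℝ} (hR : 1 ≤ R) (hs : ‖s‖ ≤ R) :
    ‖riemannXi s‖ ≤ Real.exp (30 * R ^ (3 / 2 : ℝ)) := by
  obtain ⟨n, hn1, hn2⟩ : ∃ n : ℕ, R ≤ n ∧ n ≤ 2 * R := by
    refine ⟨⌈R⌉₊, Nat.le_ceil _, ?_⟩
    have := Nat.ceil_lt_add_one (show 0 ≤ R by linarith)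
    linarith
  have hn0 : 1 ≤ n := by exact_mod_cast hR.trans hn1
  have hn0' : (1 : ℝ) ≤ n := by exact_mod_cast hn0
  have hre := abs_le.mp ((abs_re_le_norm s).trans hs)
  have h1 := norm_completedRiemannZeta₀_le (s := s) (x := 2 * n) (by linarith) (by linarith)
  have h2 := norm_completedRiemannZeta₀_two_mul_le hn0
  set T := R ^ (3 / 2 : ℝ) with hT
  have hTR : T = R * √R := by
    rw [hT, Real.sqrt_eq_rpow, ← Real.rpow_one_add' (by linarith) (by norm_num)]; norm_num
  have hRT : R ≤ T := by
    rw [hTR]; exact le_mul_of_one_le_right (by linarith) (Real.one_le_sqrt.mpr hR)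
  have hnn : (n : ℝ) ^ n ≤ Real.exp (8 * T) := by
    have hlog : Real.log n ≤ 2 * √n := by
      have := Real.log_le_self (Real.sqrt_nonneg (n : ℝ))
      rw [Real.log_sqrt (by positivity)] at this
      linarith
    have hsq : √(n : ℝ) ≤ 2 * √R := by
      rw [Real.sqrt_le_left (by positivity), mul_pow, Real.sq_sqrt (by linarith)]
      linarith
    rw [← Real.rpow_natCast, Real.rpow_def_of_pos (by linarith)]
    refine Real.exp_le_exp.mpr ?_
    have hs0 := Real.sqrt_nonneg R
    calc Real.log n * n ≤ (2 * (2 * √R)) * (2 * R) := by gcongr; linarith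
      _ = 8 * T := by rw [hTR]; ring
  have hn1n : (1 : ℝ) ≤ (n : ℝ) ^ n := one_le_pow₀ hn0'
  have hE : 1 ≤ Real.exp (8 * T) := Real.one_le_exp (by linarith)
  have h3 : ‖completedRiemannZeta₀ s‖ ≤ 3 * Real.exp (8 * T) := by linarith
  have h4 : ‖s * (s - 1)‖ ≤ 2 * R ^ 2 := by
    have : ‖s - 1‖ ≤ R + 1 := (norm_sub_le _ _).trans (by simpa using hs)
    rw [norm_mul]
    calc _ ≤ R * (R + 1) := by gcongr
      _ ≤ _ := by nlinarith
  have h5 : ‖riemannXi s‖ ≤ (2 * R ^ 2 * (3 * Real.exp (8 * T)) + 1) / 2 := by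
    rw [riemannXi, norm_div, norm_ofNat]
    gcongr
    refine (norm_add_le _ _).trans ?_
    rw [norm_mul, norm_one]
    gcongr
  have h6 : R ^ 2 ≤ Real.exp T * Real.exp T := by
    have : R ≤ Real.exp T := by linarith [Real.add_one_le_exp T]
    nlinarith
  have h7 : 4 ≤ Real.exp (4 * T) := by linarith [Real.add_one_le_exp (4 * T)]
  calc ‖riemannXi s‖ ≤ 4 * R ^ 2 * Real.exp (8 * T) := by nlinarith
    _ ≤ Real.exp (4 * T) * (Real.exp T * Real.exp T) * Real.exp (8 * T) := by gcongr
    _ = Real.exp (14 * T) := by rw [← Real.exp_add, ← Real.exp_add, ← Real.exp_add]; ring_nf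
    _ ≤ Real.exp (30 * T) := by gcongr; linarith

lemma riemannXi_eq_zero_of_riemannZeta_eq_zero {s : ℂ} (hs : riemannZeta s = 0) (h0 : 0 ≤ s.re) :
    riemannXi s = 0 := by
  have hs0 : s ≠ 0 := by rintro rfl; norm_num [riemannZeta_zero] at hs
  have hs1 : s ≠ 1 := by rintro rfl; exact riemannZeta_one_ne_zero hs
  have hG : Gammaℝ s ≠ 0 := by
    rw [Ne, Gammaℝ_eq_zero_iff]
    rintro ⟨n, rfl⟩
    have : (n : ℝ) = 0 := by
      have h1 : (0 : ℝ) ≤ n := n.cast_nonneg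
      simp at h0
      linarith
    simp_all
  rw [riemannXi_eq_mul_riemannZeta hs0 hs1 hG, hs, mul_zero]

lemma riemannZeta_eq_zero_of_riemannXi_eq_zero {s : ℂ} (hs : riemannXi s = 0) (h0 : 0 < s.re) :
    riemannZeta s = 0 := by
  have hs0 : s ≠ 0 := by rintro rfl; simp at h0
  have hs1 : s ≠ 1 := by rintro rfl; norm_num [riemannXi_one] at hs
  have hG : Gammaℝ s ≠ 0 := Gammaℝ_ne_zero_of_re_pos h0
  rw [riemannXi_eq_mul_riemannZeta hs0 hs1 hG] at hs
  simpa [hs0, sub_ne_zero.mpr hs1, hG] using hs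

/-- The product `∏ (1 + c ν (s² - s))`. -/
noncomputable def symmProd (c : ℕ → ℝ) (s : ℂ) : ℂ := ∏' ν, (1 + (c ν : ℂ) * (s ^ 2 - s))

lemma summable_norm_symmProd_term {c : ℕ → ℝ} (hc : Summable c) (s : ℂ) :
    Summable fun ν ↦ ‖(c ν : ℂ) * (s ^ 2 - s)‖ := by
  simp only [norm_mul, norm_real]
  exact hc.norm.mul_right _

lemma differentiable_symmProd {c : ℕ → ℝ} (hc : Summable c) :
    Differentiable ℂ (symmProd c) := by
  intro s
  have hprod : HasProdLocallyUniformlyOn (fun ν (s : ℂ) ↦ 1 + (c ν : ℂ) * (s ^ 2 - s))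
      (symmProd c) Set.univ := by
    refine hasProdLocallyUniformlyOn_of_forall_compact isOpen_univ fun K _ hK ↦ ?_
    obtain ⟨B, hB⟩ := hK.exists_bound_of_continuousOn (f := fun s : ℂ ↦ s ^ 2 - s) (by fun_prop)
    refine Summable.hasProdUniformlyOn_one_add hK (hc.norm.mul_right B) ?_ (by fun_prop)
    refine .of_forall fun ν z hz ↦ ?_
    rw [norm_mul, norm_real]
    exact mul_le_mul_of_nonneg_left (hB z hz) (norm_nonneg _)
  have := hprod.differentiableOn (.of_forall fun S ↦ by
    have : Differentiable ℂ fun z : ℂ ↦ ∏ ν ∈ S, (1 + (c ν : ℂ) * (z ^ 2 - z)) := by fun_prop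
    exact this.differentiableOn) isOpen_univ
  exact (this s (Set.mem_univ s)).differentiableAt univ_mem

lemma symmProd_one_sub (c : ℕ → ℝ) (s : ℂ) : symmProd c (1 - s) = symmProd c s := by
  unfold symmProd
  congr! 4
  ring

lemma symmProd_zero (c : ℕ → ℝ) : symmProd c 0 = 1 := by simp [symmProd]

lemma exp_le_norm_symmProd {c : ℕ → ℝ} (hc : Summable c) (hc0 : ∀ ν, 0 ≤ c ν) {s : ℂ}
    (hs : ∀ ν, c ν * ‖s ^ 2 - s‖ ≤ 1 / 2) :
    Real.exp (-(2 * ‖s ^ 2 - s‖ * ∑' ν, c ν)) ≤ ‖symmProd c s‖ := by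
  have hm := multipliable_one_add_of_summable (summable_norm_symmProd_term hc s)
  refine ge_of_tendsto hm.hasProd.norm (.of_forall fun S ↦ ?_)
  change _ ≤ ∏ ν ∈ S, ‖1 + (c ν : ℂ) * (s ^ 2 - s)‖
  have hterm (ν : ℕ) :
      Real.exp (-(2 * ‖s ^ 2 - s‖ * c ν)) ≤ ‖1 + (c ν : ℂ) * (s ^ 2 - s)‖ := by
    have h1 : 1 - c ν * ‖s ^ 2 - s‖ ≤ ‖1 + (c ν : ℂ) * (s ^ 2 - s)‖ := by
      have := norm_sub_le (1 + (c ν : ℂ) * (s ^ 2 - s)) ((c ν : ℂ) * (s ^ 2 - s))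
      rw [add_sub_cancel_right, norm_one, norm_mul, norm_real, Real.norm_of_nonneg (hc0 ν)] at this
      linarith
    refine le_trans ?_ h1
    set x := c ν * ‖s ^ 2 - s‖ with hx
    have hx0 : 0 ≤ x := mul_nonneg (hc0 ν) (norm_nonneg _)
    have h2 : 1 + 2 * x ≤ Real.exp (2 * x) := by linarith [Real.add_one_le_exp (2 * x)]
    have h3 : -(2 * ‖s ^ 2 - s‖ * c ν) = -(2 * x) := by rw [hx]; ring
    rw [h3, Real.exp_neg, inv_le_comm₀ (Real.exp_pos _) (by linarith [hs ν])]
    refine le_trans ?_ h2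
    rw [inv_le_iff_one_le_mul₀ (by linarith [hs ν])]
    nlinarith [hs ν]
  calc Real.exp (-(2 * ‖s ^ 2 - s‖ * ∑' ν, c ν))
      ≤ Real.exp (∑ ν ∈ S, -(2 * ‖s ^ 2 - s‖ * c ν)) := by
        rw [Real.exp_le_exp, Finset.sum_neg_distrib, ← Finset.mul_sum, neg_le_neg_iff]
        gcongr
        exact hc.sum_le_tsum S fun ν _ ↦ hc0 ν
    _ = ∏ ν ∈ S, Real.exp (-(2 * ‖s ^ 2 - s‖ * c ν)) := Real.exp_sum _ _
    _ ≤ _ := Finset.prod_le_prod (fun _ _ ↦ (Real.exp_pos _).le) fun ν _ ↦ hterm ν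

lemma symmProd_eq_prod_mul {c : ℕ → ℝ} (hc : Summable c) (S : Finset ℕ) (s : ℂ) :
    symmProd c s = (∏ ν ∈ S, (1 + (c ν : ℂ) * (s ^ 2 - s))) *
      symmProd (fun ν ↦ if ν ∈ S then 0 else c ν) s := by
  have hc' : Summable (fun ν ↦ if ν ∈ S then 0 else c ν) :=
    hc.abs.of_norm_bounded fun ν ↦ by split_ifs <;> simp
  have hm := multipliable_one_add_of_summable (summable_norm_symmProd_term hc' s)
  have h1 : HasProd (fun ν ↦ if ν ∈ S then 1 + (c ν : ℂ) * (s ^ 2 - s) else 1)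
      (∏ ν ∈ S, (1 + (c ν : ℂ) * (s ^ 2 - s))) := by
    have := hasProd_prod_of_ne_finset_one (L := .unconditional ℕ)
      (f := fun ν ↦ if ν ∈ S then 1 + (c ν : ℂ) * (s ^ 2 - s) else 1) (s := S)
      (fun ν hν ↦ by simp [hν])
    rwa [Finset.prod_congr rfl fun ν hν ↦ if_pos hν] at this
  have h2 := (h1.mul hm.hasProd).tprod_eq
  rw [symmProd, symmProd, ← h2]
  congr 1 with ν
  split_ifs <;> simp

/-- If `f` is locally divisible by `p` everywhere, it is globally divisible by `p`. -/
lemma exists_differentiable_mul_eq {f p : ℂ → ℂ} (hf : Continuous f) (hp : Continuous p)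
    (h : ∀ z, ∃ g : ℂ → ℂ, AnalyticAt ℂ g z ∧ ∀ᶠ w in 𝓝[≠] z, p w ≠ 0 ∧ f w = p w * g w) :
    ∃ F : ℂ → ℂ, Differentiable ℂ F ∧ ∀ z, f z = p z * F z := by
  choose g hg hfg using h
  have hquot (z : ℂ) : ∀ᶠ w in 𝓝[≠] z, f w / p w = g z w := by
    filter_upwards [hfg z] with w hw
    rw [hw.2, mul_div_cancel_left₀ _ hw.1]
  have hlim (z : ℂ) : Tendsto (fun w ↦ f w / p w) (𝓝[≠] z) (𝓝 (g z z)) :=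
    ((hg z).continuousAt.tendsto.mono_left nhdsWithin_le_nhds).congr'
      ((hquot z).mono fun w hw ↦ hw.symm)
  refine ⟨fun z ↦ g z z, fun z ↦ ?_, fun z ↦ ?_⟩
  · refine (hg z).differentiableAt.congr_of_eventuallyEq ?_
    have h1 : ∀ᶠ w in 𝓝[≠] z, ∀ᶠ u in 𝓝[≠] w, f u / p u = g z u := by
      filter_upwards [eventually_eventually_nhdsWithin.mpr (hquot z), self_mem_nhdsWithin]
        with w hw hwz
      rw [isOpen_compl_singleton.nhdsWithin_eq hwz] at hw
      exact hw.filter_mono nhdsWithin_le_nhds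
    have h2 : ∀ᶠ w in 𝓝 z, AnalyticAt ℂ (g z) w := (hg z).eventually_analyticAt
    have h3 : ∀ᶠ w in 𝓝[≠] z, g w w = g z w := by
      filter_upwards [h1, h2.filter_mono nhdsWithin_le_nhds] with w hw1 hw2
      exact tendsto_nhds_unique (hlim w)
        ((hw2.continuousAt.tendsto.mono_left nhdsWithin_le_nhds).congr'
          (hw1.mono fun u hu ↦ hu.symm))
    rw [eventually_nhdsWithin_iff] at h3
    filter_upwards [h3] with w hw
    by_cases hwz : w = z
    · rw [hwz]
    · exact hw hwz
  · have l1 : Tendsto f (𝓝[≠] z) (𝓝 (f z)) := hf.continuousAt.tendsto.mono_left nhdsWithin_le_nhds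
    have l2 : Tendsto p (𝓝[≠] z) (𝓝 (p z)) := hp.continuousAt.tendsto.mono_left nhdsWithin_le_nhds
    have l3 : Tendsto (g z) (𝓝[≠] z) (𝓝 (g z z)) :=
      (hg z).continuousAt.tendsto.mono_left nhdsWithin_le_nhds
    exact tendsto_nhds_unique l1 ((l2.mul l3).congr' ((hfg z).mono fun w hw ↦ hw.2.symm))

/-- The finite product `∏_{ν ∈ S} (1 - (s - s²) / ‖a ν‖²)`. -/
noncomputable def symmFinprod (a : ℕ → ℂ) (S : Finset ℕ) (s : ℂ) : ℂ :=
  ∏ ν ∈ S, (1 + (((‖a ν‖ ^ 2)⁻¹ : ℝ) : ℂ) * (s ^ 2 - s))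

lemma differentiable_symmFinprod (a : ℕ → ℂ) (S : Finset ℕ) :
    Differentiable ℂ (symmFinprod a S) := by
  unfold symmFinprod
  fun_prop

lemma symmFinprod_zero (a : ℕ → ℂ) (S : Finset ℕ) : symmFinprod a S 0 = 1 := by
  simp [symmFinprod]

lemma symmFinprod_one_sub (a : ℕ → ℂ) (S : Finset ℕ) (s : ℂ) :
    symmFinprod a S (1 - s) = symmFinprod a S s := by
  unfold symmFinprod
  congr! 3
  ring

lemma eventually_ne_zero_of_differentiable {f : ℂ → ℂ} (hf : Differentiable ℂ f) {x : ℂ}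
    (hx : f x ≠ 0) (z : ℂ) : ∀ᶠ w in 𝓝[≠] z, f w ≠ 0 := by
  by_contra h
  have hA : AnalyticOnNhd ℂ f Set.univ := fun w _ ↦ hf.analyticAt w
  exact hx (hA.eqOn_zero_of_preconnected_of_frequently_eq_zero isPreconnected_univ
    (Set.mem_univ z) h (Set.mem_univ x))

lemma mul_one_sub_eq_norm_sq {a : ℂ} (ha : a.re = 1 / 2) : a * (1 - a) = (‖a‖ : ℂ) ^ 2 := by
  rw [← ofReal_pow, ← normSq_eq_norm_sq]
  rw [normSq_apply]
  apply Complex.ext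
  · simp only [mul_re, sub_re, sub_im, one_re, one_im, ofReal_re, ha]
    ring
  · simp only [mul_im, sub_re, sub_im, one_re, one_im, ofReal_im, ha]
    ring

lemma one_add_inv_norm_sq_mul {a : ℂ} (ha : a.re = 1 / 2) (s : ℂ) :
    1 + (((‖a‖ ^ 2)⁻¹ : ℝ) : ℂ) * (s ^ 2 - s) = (s - a) * ((s - (1 - a)) / (‖a‖ : ℂ) ^ 2) := by
  have h0 : (‖a‖ : ℂ) ^ 2 ≠ 0 := by
    have : a ≠ 0 := by rintro rfl; simp at ha
    simpa using this
  have := mul_one_sub_eq_norm_sq ha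
  push_cast
  rw [← mul_div_assoc, eq_div_iff h0, add_mul, mul_right_comm, inv_mul_cancel₀ h0, ← this]
  ring

lemma symmFinprod_ne_zero {a : ℕ → ℂ} (ha : ∀ ν, (a ν).re = 1 / 2) {S : Finset ℕ} {s : ℂ}
    (h1 : ∀ ν ∈ S, s ≠ a ν) (h2 : ∀ ν ∈ S, s ≠ 1 - a ν) : symmFinprod a S s ≠ 0 := by
  refine Finset.prod_ne_zero_iff.mpr fun ν hν ↦ ?_
  have h0 : (‖a ν‖ : ℂ) ^ 2 ≠ 0 := by
    have h := ha ν
    have : a ν ≠ 0 := by intro h'; simp [h'] at h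
    simpa using this
  rw [one_add_inv_norm_sq_mul (ha ν)]
  exact mul_ne_zero (sub_ne_zero.mpr (h1 ν hν)) (div_ne_zero (sub_ne_zero.mpr (h2 ν hν)) h0)

lemma symmFinprod_eq_pow_mul {a : ℕ → ℂ} {z : ℂ} (hz : z.re = 1 / 2) (S : Finset ℕ) (s : ℂ) :
    symmFinprod a S s = (s - z) ^ (S.filter (a · = z)).card *
      (((s - (1 - z)) / (‖z‖ : ℂ) ^ 2) ^ (S.filter (a · = z)).card *
        symmFinprod a (S.filter (a · ≠ z)) s) := by
  rw [symmFinprod, ← Finset.prod_filter_mul_prod_filter_not S (a · = z), ← mul_assoc, ← mul_pow,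
    symmFinprod]
  congr 1
  rw [Finset.prod_eq_pow_card]
  intro ν hν
  rw [(Finset.mem_filter.mp hν).2, one_add_inv_norm_sq_mul hz]

lemma analyticAt_Gammaℝ {z : ℂ} (hz : Gammaℝ z ≠ 0) : AnalyticAt ℂ Gammaℝ z := by
  have h := (differentiable_Gammaℝ_inv.analyticAt z).inv (inv_ne_zero hz)
  have he : (fun s ↦ (Gammaℝ s)⁻¹)⁻¹ = Gammaℝ := by ext s; simp
  rwa [he] at h

lemma exists_riemannXi_eq_symmFinprod_mul_of_im_pos {sν : ℕ → ℂ}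
    (henum : CriticalZeroEnumFor riemannZeta sν) (S : Finset ℕ) {z : ℂ} (hz : 0 < z.im) :
    ∃ g : ℂ → ℂ, AnalyticAt ℂ g z ∧
      (∀ᶠ w in 𝓝[≠] z, symmFinprod sν S w ≠ 0 ∧ riemannXi w = symmFinprod sν S w * g w) ∧
      ((∀ ν, sν ν = z → ν ∈ S) → z.re = 1 / 2 → g z ≠ 0) := by
  have hre ν := (henum.1 ν).1
  have hP : ∀ᶠ w in 𝓝[≠] z, symmFinprod sν S w ≠ 0 :=
    eventually_ne_zero_of_differentiable (differentiable_symmFinprod sν S) (x := 0)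
      (by simp [symmFinprod_zero]) z
  have hconj ν : z ≠ 1 - sν ν := by
    intro h
    have h1 := (henum.1 ν).2.1
    rw [h] at hz
    simp at hz
    linarith
  have hz0 : z ≠ 0 := by rintro rfl; simp at hz
  have hz1 : z ≠ 1 := by rintro rfl; simp at hz
  by_cases hzero : z.re = 1 / 2 ∧ riemannZeta z = 0
  · obtain ⟨hzre, hζ⟩ := hzero
    obtain ⟨g₀, hg₀, hg₀z, hg₀e⟩ := henum.2 z hzre hz hζ
    set m := Nat.card {ν : ℕ // sν ν = z} with hm
    have hm0 : m ≠ 0 := by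
      intro h0
      simp only [h0, pow_zero, one_mul] at hg₀e
      have l1 : Tendsto riemannZeta (𝓝[≠] z) (𝓝 (riemannZeta z)) :=
        (differentiableAt_riemannZeta hz1).continuousAt.tendsto.mono_left nhdsWithin_le_nhds
      have l2 : Tendsto g₀ (𝓝[≠] z) (𝓝 (g₀ z)) :=
        hg₀.continuousAt.tendsto.mono_left nhdsWithin_le_nhds
      exact hg₀z ((tendsto_nhds_unique l1 (l2.congr' (hg₀e.mono fun _ h ↦ h.symm))).symm.trans hζ)
    have hfin : Finite {ν : ℕ // sν ν = z} := Nat.finite_of_card_ne_zero hm0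
    set T := S.filter (sν · = z) with hT
    have hTcoe : ((T : Set ℕ)) ⊆ {ν | sν ν = z} := by
      intro ν hν; exact (Finset.mem_filter.mp (Finset.mem_coe.mp hν)).2
    have hfin' : {ν : ℕ | sν ν = z}.Finite := hfin
    have hcard : T.card ≤ m := by
      have := Set.ncard_le_ncard hTcoe hfin'
      rwa [Set.ncard_coe_finset, ← Nat.card_coe_set_eq] at this
    have hcardeq (hS : ∀ ν, sν ν = z → ν ∈ S) : T.card = m := by
      have : (T : Set ℕ) = {ν | sν ν = z} := by
        ext ν
        simp only [hT, Finset.coe_filter, Set.mem_ofPred_eq, and_iff_right_iff_imp]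
        exact hS ν
      rw [hm, ← Set.ncard_coe_finset, this]; rfl
    set B : ℂ → ℂ := fun w ↦ ((w - (1 - z)) / (‖z‖ : ℂ) ^ 2) ^ T.card *
        symmFinprod sν (S.filter (sν · ≠ z)) w with hB
    have hBz : B z ≠ 0 := by
      refine mul_ne_zero (pow_ne_zero _ (div_ne_zero ?_ (by simpa using hz0)))
        (symmFinprod_ne_zero hre ?_ fun ν _ ↦ hconj ν)
      · intro h
        have := congrArg Complex.im h
        simp at this
        linarith
      · intro ν hν h
        exact (Finset.mem_filter.mp hν).2 h.symm
    have hBd : Differentiable ℂ B := by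
      have := differentiable_symmFinprod sν (S.filter (sν · ≠ z))
      rw [hB]
      fun_prop
    have hGz : Gammaℝ z ≠ 0 := Gammaℝ_ne_zero_of_re_pos (by rw [hzre]; norm_num)
    refine ⟨fun w ↦ w / 2 * (w - 1) * Gammaℝ w * (w - z) ^ (m - T.card) * g₀ w / B w, ?_, ?_, ?_⟩
    · have hG := analyticAt_Gammaℝ hGz
      have hBa := hBd.analyticAt z
      have : AnalyticAt ℂ (fun w : ℂ ↦ w / 2 * (w - 1) * Gammaℝ w * (w - z) ^ (m - T.card) * g₀ w)
          z := by fun_prop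
      exact this.fun_div hBa hBz
    · have e1 : ∀ᶠ w in 𝓝[≠] z, B w ≠ 0 :=
        (hBd.continuous.continuousAt.eventually_ne hBz).filter_mono nhdsWithin_le_nhds
      have e2 : ∀ᶠ w in 𝓝[≠] z, w ≠ 0 := (eventually_ne_nhds hz0).filter_mono nhdsWithin_le_nhds
      have e3 : ∀ᶠ w in 𝓝[≠] z, w ≠ 1 := (eventually_ne_nhds hz1).filter_mono nhdsWithin_le_nhds
      have e4 : ∀ᶠ w in 𝓝[≠] z, Gammaℝ w ≠ 0 :=
        ((analyticAt_Gammaℝ hGz).continuousAt.eventually_ne hGz).filter_mono nhdsWithin_le_nhds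
      filter_upwards [hP, hg₀e, e1, e2, e3, e4] with w h1 h2 h3 h4 h5 h6
      refine ⟨h1, ?_⟩
      rw [riemannXi_eq_mul_riemannZeta h4 h5 h6, h2, symmFinprod_eq_pow_mul hzre S w]
      change _ = (w - z) ^ T.card * B w * _
      rw [mul_assoc _ (B w), mul_div_cancel₀ _ h3, ← Nat.add_sub_of_le hcard, pow_add,
        Nat.add_sub_cancel_left]
      ring
    · intro hS _
      have : m - T.card = 0 := by rw [hcardeq hS, Nat.sub_self]
      rw [this]
      refine div_ne_zero (mul_ne_zero ?_ hg₀z) hBz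
      simp [hz0, sub_ne_zero.mpr hz1, hGz]
  · have hPz : symmFinprod sν S z ≠ 0 := by
      refine symmFinprod_ne_zero hre (fun ν _ h ↦ hzero ?_) fun ν _ ↦ hconj ν
      rw [h]
      exact ⟨hre ν, (henum.1 ν).2.2⟩
    refine ⟨fun w ↦ riemannXi w / symmFinprod sν S w, ?_, ?_, ?_⟩
    · exact (differentiable_riemannXi.analyticAt z).fun_div
        ((differentiable_symmFinprod sν S).analyticAt z) hPz
    · filter_upwards [hP] with w hw
      exact ⟨hw, (mul_div_cancel₀ _ hw).symm⟩
    · intro _ hzre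
      refine div_ne_zero (fun h ↦ hzero ⟨hzre, ?_⟩) hPz
      exact riemannZeta_eq_zero_of_riemannXi_eq_zero h (by rw [hzre]; norm_num)

lemma exists_differentiable_riemannXi_eq_symmFinprod_mul {sν : ℕ → ℂ}
    (henum : CriticalZeroEnumFor riemannZeta sν) (S : Finset ℕ) :
    ∃ F : ℂ → ℂ, Differentiable ℂ F ∧ ∀ z, riemannXi z = symmFinprod sν S z * F z := by
  refine exists_differentiable_mul_eq differentiable_riemannXi.continuous
    (differentiable_symmFinprod sν S).continuous fun z ↦ ?_
  have hP : ∀ᶠ w in 𝓝[≠] z, symmFinprod sν S w ≠ 0 :=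
    eventually_ne_zero_of_differentiable (differentiable_symmFinprod sν S) (x := 0)
      (by simp [symmFinprod_zero]) z
  rcases lt_trichotomy z.im 0 with hz | hz | hz
  · obtain ⟨g, hg, hge, -⟩ := exists_riemannXi_eq_symmFinprod_mul_of_im_pos henum S (z := 1 - z)
      (by simpa using hz)
    refine ⟨fun w ↦ g (1 - w), hg.fun_comp (f := fun w ↦ 1 - w) (by fun_prop), ?_⟩
    have ht : Tendsto (fun w : ℂ ↦ 1 - w) (𝓝[≠] z) (𝓝[≠] (1 - z)) := by
      refine tendsto_nhdsWithin_iff.mpr ⟨?_, ?_⟩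
      · exact (Continuous.tendsto (by fun_prop) z).mono_left nhdsWithin_le_nhds
      · filter_upwards [self_mem_nhdsWithin] with w hw
        simpa using hw
    filter_upwards [ht.eventually hge] with w hw
    rwa [riemannXi_one_sub, symmFinprod_one_sub] at hw
  · have hPz : symmFinprod sν S z ≠ 0 := by
      refine symmFinprod_ne_zero (fun ν ↦ (henum.1 ν).1) (fun ν _ h ↦ ?_) fun ν _ h ↦ ?_
      · exact (henum.1 ν).2.1.ne' (h ▸ hz)
      · have h1 := (henum.1 ν).2.1
        rw [h] at hz
        simp at hz
        linarith
    refine ⟨fun w ↦ riemannXi w / symmFinprod sν S w, ?_, ?_⟩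
    · exact (differentiable_riemannXi.analyticAt z).fun_div
        ((differentiable_symmFinprod sν S).analyticAt z) hPz
    · filter_upwards [hP] with w hw
      exact ⟨hw, (mul_div_cancel₀ _ hw).symm⟩
  · obtain ⟨g, hg, hge, -⟩ := exists_riemannXi_eq_symmFinprod_mul_of_im_pos henum S hz
    exact ⟨g, hg, hge⟩

lemma twelve_mul_sq_le_norm_sq_sub {s : ℂ} {R : ℝ} (hR : 1 ≤ R) (hs : ‖s‖ = 4 * R) :
    12 * R ^ 2 ≤ ‖s ^ 2 - s‖ := by
  have := norm_sub_norm_le (s ^ 2) s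
  rw [norm_pow, hs] at this
  nlinarith

lemma norm_mul_two_pow_card_le {a : ℕ → ℂ} (ha : ∀ ν, a ν ≠ 0) {S : Finset ℕ} {R : ℝ}
    (hR : 1 ≤ R) (hS : ∀ ν ∈ S, ‖a ν‖ ≤ 2 * R) {F : ℂ → ℂ} (hF : Differentiable ℂ F)
    (hξ : ∀ z, riemannXi z = symmFinprod a S z * F z) {s : ℂ} (hs : ‖s‖ ≤ 4 * R) :
    ‖F s‖ * 2 ^ S.card ≤ Real.exp (240 * R ^ (3 / 2 : ℝ)) := by
  have hR0 : (0 : ℝ) < 4 * R := by linarith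
  rw [← le_div_iff₀ (by positivity)]
  refine norm_le_of_forall_mem_frontier_norm_le (U := Metric.ball 0 (4 * R)) Metric.isBounded_ball
    hF.diffContOnCl (fun z hz ↦ ?_) (by simpa [closure_ball _ hR0.ne'] using hs)
  rw [frontier_ball _ hR0.ne', mem_sphere_zero_iff_norm] at hz
  rw [le_div_iff₀ (by positivity)]
  have hP : (2 : ℝ) ^ S.card ≤ ‖symmFinprod a S z‖ := by
    rw [symmFinprod, norm_prod, ← Finset.prod_const]
    refine Finset.prod_le_prod (by simp) fun ν hν ↦ ?_
    have h1 := twelve_mul_sq_le_norm_sq_sub hR hz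
    have h2 : 0 < ‖a ν‖ := norm_pos_iff.mpr (ha ν)
    have h3 : (3 : ℝ) ≤ (‖a ν‖ ^ 2)⁻¹ * ‖z ^ 2 - z‖ := by
      rw [inv_mul_eq_div, le_div_iff₀ (by positivity)]
      have := hS ν hν
      nlinarith
    have h4 := norm_sub_norm_le ((((‖a ν‖ ^ 2)⁻¹ : ℝ) : ℂ) * (z ^ 2 - z)) (-1)
    rw [sub_neg_eq_add, norm_neg, norm_one, norm_mul, norm_real,
      Real.norm_of_nonneg (by positivity), add_comm _ (1 : ℂ)] at h4
    linarith
  calc ‖F z‖ * 2 ^ S.card ≤ ‖F z‖ * ‖symmFinprod a S z‖ := by gcongr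
    _ = ‖riemannXi z‖ := by rw [hξ, norm_mul, mul_comm]
    _ ≤ Real.exp (30 * (4 * R) ^ (3 / 2 : ℝ)) := norm_riemannXi_le (by linarith) hz.le
    _ = Real.exp (240 * R ^ (3 / 2 : ℝ)) := by
      have h4 : (4 : ℝ) ^ (3 / 2 : ℝ) = 8 := by
        rw [show (4 : ℝ) = 2 ^ (2 : ℝ) by norm_num, ← Real.rpow_mul (by norm_num)]
        norm_num
      rw [Real.mul_rpow (by norm_num) (by linarith), h4]
      ring_nf

section Growth

variable {sν : ℕ → ℂ}

lemma CriticalZeroEnumFor.ne_zero {f : ℂ → ℂ} (henum : CriticalZeroEnumFor f sν) (ν : ℕ) :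
    sν ν ≠ 0 := by
  intro h
  have := (henum.1 ν).1
  simp [h] at this

lemma CriticalZeroEnumFor.half_le_norm {f : ℂ → ℂ} (henum : CriticalZeroEnumFor f sν) (ν : ℕ) :
    1 / 2 ≤ ‖sν ν‖ :=
  (henum.1 ν).1 ▸ re_le_norm (sν ν)

lemma card_le_of_norm_le (henum : CriticalZeroEnumFor riemannZeta sν) {S : Finset ℕ} {R : ℝ}
    (hR : 1 ≤ R) (hS : ∀ ν ∈ S, ‖sν ν‖ ≤ 2 * R) : (S.card : ℝ) ≤ 500 * R ^ (3 / 2 : ℝ) := by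
  obtain ⟨F, hF, hξ⟩ := exists_differentiable_riemannXi_eq_symmFinprod_mul henum S
  have h := norm_mul_two_pow_card_le henum.ne_zero hR hS hF hξ (s := 0) (by simp; linarith)
  have hF0 : F 0 = 1 / 2 := by
    have := hξ 0
    rw [riemannXi_zero, symmFinprod_zero, one_mul] at this
    exact this.symm
  have hR1 : 1 ≤ R ^ (3 / 2 : ℝ) := Real.one_le_rpow hR (by norm_num)
  have h2 : (2 : ℝ) ^ S.card = Real.exp (S.card * Real.log 2) := by
    rw [mul_comm, Real.exp_mul, Real.exp_log two_pos, Real.rpow_natCast]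
  have h3 : (1 / 2 : ℝ) = Real.exp (-Real.log 2) := by
    rw [Real.exp_neg, Real.exp_log two_pos]; norm_num
  have h4 : ‖F 0‖ = 1 / 2 := by rw [hF0]; norm_num
  rw [h4, h2, h3, ← Real.exp_add, Real.exp_le_exp] at h
  have := Real.log_two_gt_d9
  have := Real.log_two_lt_d9
  nlinarith [(Nat.cast_nonneg S.card : (0 : ℝ) ≤ S.card)]

lemma summable_norm_rpow (henum : CriticalZeroEnumFor riemannZeta sν) :
    Summable fun ν ↦ ‖sν ν‖ ^ (-(7 / 4) : ℝ) := by
  have hk (ν : ℕ) : ∃ k : ℕ, (2 : ℝ) ^ k / 2 ≤ ‖sν ν‖ ∧ ‖sν ν‖ ≤ 2 ^ k := by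
    obtain ⟨k, h1, h2⟩ := exists_nat_pow_near (x := 2 * ‖sν ν‖) (y := 2)
      (by linarith [henum.half_le_norm ν]) one_lt_two
    rw [pow_succ] at h2
    exact ⟨k, by linarith, by linarith⟩
  choose κ hκ1 hκ2 using hk
  set q : ℝ := 2 ^ (-(1 / 4) : ℝ) with hq
  have hq0 : 0 < q := by positivity
  have hq1 : q < 1 := Real.rpow_lt_one_of_one_lt_of_neg one_lt_two (by norm_num)
  have hsum : Summable fun k : ℕ ↦ 2000 * q ^ k :=
    (summable_geometric_of_lt_one hq0.le hq1).mul_left _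
  refine summable_of_sum_le (c := ∑' k : ℕ, 2000 * q ^ k) (fun ν ↦ by positivity) fun S ↦ ?_
  rw [← Finset.sum_fiberwise_of_maps_to (t := S.image κ) (g := κ)
    (fun ν hν ↦ Finset.mem_image_of_mem κ hν)]
  refine le_trans (Finset.sum_le_sum fun k _ ↦ ?_)
    (hsum.sum_le_tsum (S.image κ) fun k _ ↦ by positivity)
  have h2k : (1 : ℝ) ≤ 2 ^ k := one_le_pow₀ one_le_two
  have hcard : ((S.filter (κ · = k)).card : ℝ) ≤ 500 * ((2 : ℝ) ^ k) ^ (3 / 2 : ℝ) := by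
    refine card_le_of_norm_le henum h2k fun ν hν ↦ ?_
    have := hκ2 ν
    rw [(Finset.mem_filter.mp hν).2] at this
    linarith
  have hterm : ∀ ν ∈ S.filter (κ · = k), ‖sν ν‖ ^ (-(7 / 4) : ℝ) ≤
      4 * ((2 : ℝ) ^ k) ^ (-(7 / 4) : ℝ) := by
    intro ν hν
    have h1 := hκ1 ν
    rw [(Finset.mem_filter.mp hν).2] at h1
    calc ‖sν ν‖ ^ (-(7 / 4) : ℝ) ≤ ((2 : ℝ) ^ k / 2) ^ (-(7 / 4) : ℝ) :=
          Real.rpow_le_rpow_of_nonpos (by positivity) h1 (by norm_num)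
      _ = 2 ^ (7 / 4 : ℝ) * ((2 : ℝ) ^ k) ^ (-(7 / 4) : ℝ) := by
          rw [Real.div_rpow (by positivity) (by norm_num), div_eq_mul_inv, ← Real.rpow_neg two_pos.le,
            neg_neg, mul_comm]
      _ ≤ _ := by
          gcongr
          calc (2 : ℝ) ^ (7 / 4 : ℝ) ≤ 2 ^ (2 : ℝ) :=
                Real.rpow_le_rpow_of_exponent_le one_le_two (by norm_num)
            _ = 4 := by norm_num
  calc ∑ ν ∈ S.filter (κ · = k), ‖sν ν‖ ^ (-(7 / 4) : ℝ)
      ≤ (S.filter (κ · = k)).card * (4 * ((2 : ℝ) ^ k) ^ (-(7 / 4) : ℝ)) := by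
        rw [← nsmul_eq_mul]
        exact Finset.sum_le_card_nsmul _ _ _ hterm
    _ ≤ 500 * ((2 : ℝ) ^ k) ^ (3 / 2 : ℝ) * (4 * ((2 : ℝ) ^ k) ^ (-(7 / 4) : ℝ)) := by gcongr
    _ = 2000 * (((2 : ℝ) ^ k) ^ (3 / 2 : ℝ) * ((2 : ℝ) ^ k) ^ (-(7 / 4) : ℝ)) := by ring
    _ = 2000 * q ^ k := by
        rw [← Real.rpow_add (by positivity), hq, ← Real.rpow_natCast, ← Real.rpow_natCast,
          ← Real.rpow_mul two_pos.le, ← Real.rpow_mul two_pos.le]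
        norm_num [mul_comm]

lemma inv_norm_sq_le (henum : CriticalZeroEnumFor riemannZeta sν) {R : ℝ} (hR : 0 < R) {ν : ℕ}
    (h : R ≤ ‖sν ν‖) :
    (‖sν ν‖ ^ 2)⁻¹ ≤ R ^ (-(1 / 4) : ℝ) * ‖sν ν‖ ^ (-(7 / 4) : ℝ) := by
  have h0 : 0 < ‖sν ν‖ := norm_pos_iff.mpr (henum.ne_zero ν)
  calc (‖sν ν‖ ^ 2)⁻¹ = ‖sν ν‖ ^ (-(1 / 4) : ℝ) * ‖sν ν‖ ^ (-(7 / 4) : ℝ) := by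
        rw [← Real.rpow_add h0, ← Real.rpow_natCast, ← Real.rpow_neg h0.le]
        norm_num
    _ ≤ _ := by
        gcongr ?_ * _
        exact Real.rpow_le_rpow_of_nonpos hR h (by norm_num)

lemma summable_inv_norm_sq (henum : CriticalZeroEnumFor riemannZeta sν) :
    Summable fun ν ↦ (‖sν ν‖ ^ 2)⁻¹ :=
  ((summable_norm_rpow henum).mul_left _).of_nonneg_of_le (fun ν ↦ by positivity)
    fun ν ↦ inv_norm_sq_le henum (by norm_num) (henum.half_le_norm ν)

lemma finite_norm_le (henum : CriticalZeroEnumFor riemannZeta sν) (R : ℝ) :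
    {ν | ‖sν ν‖ ≤ R}.Finite := by
  have hR : (0 : ℝ) < ((max R 1) ^ 2)⁻¹ := by positivity
  have h := (summable_inv_norm_sq henum).tendsto_cofinite_zero.eventually_lt_const hR
  refine Set.Finite.subset (Filter.eventually_cofinite.mp h) fun ν hν ↦ ?_
  have h0 : 0 < ‖sν ν‖ := norm_pos_iff.mpr (henum.ne_zero ν)
  have : ‖sν ν‖ ≤ max R 1 := le_max_of_le_left hν
  simp only [Set.mem_ofPred_eq, not_lt]
  gcongr

lemma hfun_eq (s : ℂ) : hfun sν s = 1 / 2 * symmProd (fun ν ↦ (‖sν ν‖ ^ 2)⁻¹) s := by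
  rw [hfun, symmProd]
  congr! 3 with ν
  push_cast
  ring

lemma eq_of_forall_mul_eq_mul {p f g : ℂ → ℂ} (hp : Differentiable ℂ p) {x : ℂ} (hx : p x ≠ 0)
    (hf : Continuous f) (hg : Continuous g) (h : ∀ z, p z * f z = p z * g z) (z : ℂ) :
    f z = g z := by
  refine tendsto_nhds_unique (hf.continuousAt.tendsto.mono_left nhdsWithin_le_nhds)
    ((hg.continuousAt.tendsto.mono_left (nhdsWithin_le_nhds (s := {z}ᶜ))).congr' ?_)
  filter_upwards [eventually_ne_zero_of_differentiable hp hx z] with w hw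
  exact mul_left_cancel₀ hw (h w).symm

lemma exists_hfun_mul_eq_riemannXi (henum : CriticalZeroEnumFor riemannZeta sν) :
    ∃ F : ℂ → ℂ, Differentiable ℂ F ∧ (∀ z, riemannXi z = hfun sν z * F z) ∧
      (∃ K, ∀ R : ℝ, 1 ≤ R → ∀ s : ℂ, ‖s‖ ≤ R → ‖F s‖ ≤ Real.exp (K * R ^ (7 / 4 : ℝ))) ∧
      ∀ z : ℂ, 0 < z.im → z.re = 1 / 2 → F z ≠ 0 := by
  set c : ℕ → ℝ := fun ν ↦ (‖sν ν‖ ^ 2)⁻¹ with hc_def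
  have hc : Summable c := summable_inv_norm_sq henum
  have hc0 ν : 0 ≤ c ν := by positivity
  set A : ℝ := ∑' ν, ‖sν ν‖ ^ (-(7 / 4) : ℝ) with hA_def
  have hsumA := summable_norm_rpow henum
  have hh := differentiable_symmProd hc
  set S : ℝ → Finset ℕ := fun R ↦ (finite_norm_le henum (2 * R)).toFinset with hS_def
  have hS R ν : ν ∈ S R ↔ ‖sν ν‖ ≤ 2 * R := by simp [hS_def]
  set d : ℝ → ℕ → ℝ := fun R ν ↦ if ν ∈ S R then 0 else c ν with hd_def
  have hd0 R ν : 0 ≤ d R ν := by simp only [hd_def]; split_ifs <;> simp [hc0]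
  have hdc R ν : d R ν ≤ c ν := by simp only [hd_def]; split_ifs <;> simp [hc0]
  have hd R : Summable (d R) := hc.of_nonneg_of_le (hd0 R) (hdc R)
  have hT R := differentiable_symmProd (hd R)
  have hprod R s : hfun sν s = symmFinprod sν (S R) s * (1 / 2 * symmProd (d R) s) := by
    rw [hfun_eq, symmProd_eq_prod_mul hc (S R), symmFinprod]
    ring
  have hlow (R : ℝ) (hR : 1 ≤ R) (s : ℂ) (hs : ‖s‖ ≤ R) :
      Real.exp (-(4 * A * R ^ (7 / 4 : ℝ))) ≤ ‖symmProd (d R) s‖ := by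
    have hv : ‖s ^ 2 - s‖ ≤ 2 * R ^ 2 := by
      refine (norm_sub_le _ _).trans ?_
      rw [norm_pow]
      nlinarith [norm_nonneg s]
    have hR0 : 0 < R := by linarith
    refine le_trans ?_ (exp_le_norm_symmProd (hd R) (hd0 R) fun ν ↦ ?_)
    · rw [Real.exp_le_exp, neg_le_neg_iff]
      have htail : ∑' ν, d R ν ≤ R ^ (-(1 / 4) : ℝ) * A := by
        rw [hA_def, ← tsum_mul_left]
        refine (hd R).tsum_le_tsum (fun ν ↦ ?_) (hsumA.mul_left _)
        simp only [hd_def]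
        split_ifs with h
        · positivity
        · rw [hS, not_le] at h
          exact inv_norm_sq_le henum hR0 (by linarith)
      calc 2 * ‖s ^ 2 - s‖ * ∑' ν, d R ν ≤ 2 * (2 * R ^ 2) * (R ^ (-(1 / 4) : ℝ) * A) := by
            gcongr
        _ = 4 * A * (R ^ (2 : ℝ) * R ^ (-(1 / 4) : ℝ)) := by rw [Real.rpow_two]; ring
        _ = 4 * A * R ^ (7 / 4 : ℝ) := by rw [← Real.rpow_add hR0]; norm_num
    · simp only [hd_def]
      split_ifs with h
      · simp
      · rw [hS, not_le] at h
        rw [hc_def, inv_mul_eq_div, div_le_iff₀ (by nlinarith)]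
        nlinarith
  have hTne (R : ℝ) (hR : 1 ≤ R) (s : ℂ) (hs : ‖s‖ ≤ R) : symmProd (d R) s ≠ 0 :=
    norm_pos_iff.mp ((Real.exp_pos _).trans_le (hlow R hR s hs))
  choose G hG hGξ using fun R : ℝ ↦ exists_differentiable_riemannXi_eq_symmFinprod_mul henum (S R)
  have hhd : Differentiable ℂ (hfun sν) := by
    have : hfun sν = fun s ↦ 1 / 2 * symmProd c s := by ext s; exact hfun_eq s
    rw [this]
    fun_prop
  have hh0 : hfun sν 0 ≠ 0 := by rw [hfun_eq, symmProd_zero]; norm_num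
  obtain ⟨F, hF, hξF⟩ : ∃ F : ℂ → ℂ, Differentiable ℂ F ∧ ∀ z, riemannXi z = hfun sν z * F z := by
    refine exists_differentiable_mul_eq differentiable_riemannXi.continuous hhd.continuous
      fun z ↦ ?_
    set R := ‖z‖ + 1 with hR_def
    have hR : 1 ≤ R := by linarith [norm_nonneg z]
    refine ⟨fun w ↦ G R w / (1 / 2 * symmProd (d R) w), ?_, ?_⟩
    · refine ((hG R).analyticAt z).fun_div ?_ ?_
      · exact Differentiable.analyticAt (by have := hT R; fun_prop) z
      · exact mul_ne_zero (by norm_num) (hTne R hR z (by linarith))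
    · have h1 : ∀ᶠ w in 𝓝[≠] z, symmProd (d R) w ≠ 0 :=
        ((hT R).continuous.continuousAt.eventually_ne (hTne R hR z (by linarith))).filter_mono
          nhdsWithin_le_nhds
      filter_upwards [eventually_ne_zero_of_differentiable hhd hh0 z, h1] with w hw1 hw2
      refine ⟨hw1, ?_⟩
      rw [hGξ R, hprod R, mul_assoc, mul_div_cancel₀]
      exact mul_ne_zero (by norm_num) hw2
  have hFG (R : ℝ) (z : ℂ) : 1 / 2 * symmProd (d R) z * F z = G R z := by
    refine eq_of_forall_mul_eq_mul (differentiable_symmFinprod sν (S R)) (x := 0)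
      (by simp [symmFinprod_zero]) (f := fun z ↦ 1 / 2 * symmProd (d R) z * F z) ?_
      (hG R).continuous (fun w ↦ ?_) z
    · have := (hT R).continuous
      have := hF.continuous
      fun_prop
    · rw [← hGξ R, hξF, hprod R, mul_assoc, mul_assoc, mul_assoc]
  refine ⟨F, hF, hξF, ⟨1 + 240 + 4 * A, fun R hR s hs ↦ ?_⟩, fun z hz hzre hFz ↦ ?_⟩
  · have h1 := hlow R hR s hs
    have h2 := norm_mul_two_pow_card_le henum.ne_zero hR (fun ν hν ↦ (hS R ν).mp hν) (hG R)
      (hGξ R) (s := s) (by linarith)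
    have h3 : ‖G R s‖ ≤ Real.exp (240 * R ^ (3 / 2 : ℝ)) :=
      (le_mul_of_one_le_right (norm_nonneg _) (one_le_pow₀ one_le_two)).trans h2
    have h4 : R ^ (3 / 2 : ℝ) ≤ R ^ (7 / 4 : ℝ) :=
      Real.rpow_le_rpow_of_exponent_le hR (by norm_num)
    have h5 : 1 ≤ R ^ (7 / 4 : ℝ) := Real.one_le_rpow hR (by norm_num)
    rw [← hFG, norm_mul, norm_mul] at h3
    norm_num at h3
    have h6 : Real.exp (-(4 * A * R ^ (7 / 4 : ℝ))) * ‖F s‖ ≤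
        2 * Real.exp (240 * R ^ (3 / 2 : ℝ)) := by
      nlinarith [norm_nonneg (F s), mul_le_mul_of_nonneg_right h1 (norm_nonneg (F s))]
    rw [Real.exp_neg, inv_mul_le_iff₀ (Real.exp_pos _)] at h6
    refine h6.trans ?_
    have h7 : (2 : ℝ) ≤ Real.exp (R ^ (7 / 4 : ℝ)) := by
      linarith [Real.add_one_le_exp (R ^ (7 / 4 : ℝ))]
    calc Real.exp (4 * A * R ^ (7 / 4 : ℝ)) * (2 * Real.exp (240 * R ^ (3 / 2 : ℝ)))
        ≤ Real.exp (4 * A * R ^ (7 / 4 : ℝ)) *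
            (Real.exp (R ^ (7 / 4 : ℝ)) * Real.exp (240 * R ^ (7 / 4 : ℝ))) := by gcongr
      _ = _ := by rw [← Real.exp_add, ← Real.exp_add]; ring_nf
  · set R := ‖z‖ + 1 with hR_def
    obtain ⟨g, hg, hge, hgz⟩ := exists_riemannXi_eq_symmFinprod_mul_of_im_pos henum (S R) hz
    refine hgz (fun ν hν ↦ ?_) hzre ?_
    · rw [hS, hν]
      linarith [norm_nonneg z]
    · have hGz : G R z = 0 := by rw [← hFG, hFz, mul_zero]
      rw [← hGz]
      refine tendsto_nhds_unique (hg.continuousAt.tendsto.mono_left nhdsWithin_le_nhds)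
        (((hG R).continuous.continuousAt.tendsto.mono_left
          (nhdsWithin_le_nhds (s := {z}ᶜ))).congr' ?_)
      filter_upwards [hge] with w hw
      exact mul_left_cancel₀ hw.1 ((hGξ R w).symm.trans hw.2)

end Growth

/-- A zero-free entire function of order less than two which is symmetric about `1/2` is
constant. -/
lemma eq_one_of_forall_ne_zero {F : ℂ → ℂ} (hF : Differentiable ℂ F) (hne : ∀ z, F z ≠ 0)
    (h0 : F 0 = 1) (hsymm : ∀ s, F (1 - s) = F s) {K : ℝ}
    (hK : ∀ R : ℝ, 1 ≤ R → ∀ s : ℂ, ‖s‖ ≤ R → ‖F s‖ ≤ Real.exp (K * R ^ (7 / 4 : ℝ))) (s : ℂ) :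
    F s = 1 := by
  have hlog : Differentiable ℂ fun z ↦ deriv F z / F z :=
    fun z ↦ (hF.deriv z).fun_div (hF z) (hne z)
  obtain ⟨g, hg⟩ := hlog.isExactOn_univ.with_val_at 0 0
  have hg0 : g 0 = 0 := by simp_all
  have hg' z : HasDerivAt g (deriv F z / F z) z := by simp_all
  have hgd : Differentiable ℂ g := fun z ↦ (hg' z).differentiableAt
  have hexp z : F z = exp (g z) := by
    have hd (w : ℂ) : HasDerivAt (fun w ↦ F w * exp (-g w)) 0 w := by
      have := (hF w).hasDerivAt.fun_mul (hg' w).fun_neg.cexp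
      refine this.congr_deriv ?_
      have hw : F w * (deriv F w / F w) = deriv F w := mul_div_cancel₀ _ (hne w)
      linear_combination -exp (-g w) * hw
    have := is_const_of_deriv_eq_zero (fun w ↦ (hd w).differentiableAt) (fun w ↦ (hd w).deriv) z 0
    rw [h0, hg0, exp_neg, neg_zero, exp_zero, mul_one] at this
    rw [← mul_one (exp (g z)), ← this]
    field_simp [exp_ne_zero]
  set M := max K 1 with hM
  have hM1 : 1 ≤ M := le_max_right _ _
  have hre (R : ℝ) (hR : 1 ≤ R) (z : ℂ) (hz : ‖z‖ ≤ R) : (g z).re ≤ M * R ^ (7 / 4 : ℝ) := by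
    have h := hK R hR z hz
    rw [hexp, norm_exp, Real.exp_le_exp] at h
    refine h.trans ?_
    gcongr
    exact le_max_left _ _
  have hgn (R : ℝ) (hR : 1 ≤ R) (z : ℂ) (hz : ‖z‖ ≤ 2 * R) :
      ‖g z‖ ≤ 2 * (M * (4 * R) ^ (7 / 4 : ℝ)) := by
    have h := borelCaratheodory (M := M * (4 * R) ^ (7 / 4 : ℝ)) (R := 4 * R) (z := z)
      (by positivity) hgd.differentiableOn
      (fun w hw ↦ hre _ (by linarith) w (mem_ball_zero_iff.mp hw).le) (by linarith)
      (mem_ball_zero_iff.mpr (by linarith))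
    rw [hg0, norm_zero, zero_mul, zero_div, add_zero] at h
    refine h.trans ?_
    rw [div_le_iff₀ (by linarith)]
    gcongr
    linarith
  have hd2 (c : ℂ) : deriv (deriv g) c = 0 := by
    have hb (R : ℝ) (hR : ‖c‖ + 1 ≤ R) :
        ‖deriv (deriv g) c‖ ≤ 4 * M * 4 ^ (7 / 4 : ℝ) * R ^ (-(1 / 4) : ℝ) := by
      have hR1 : 1 ≤ R := by linarith [norm_nonneg c]
      have hR0 : 0 < R := by linarith
      have h := norm_iteratedDeriv_le_of_forall_mem_sphere_norm_le 2 hR0 (c := c)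
        hgd.diffContOnCl (C := 2 * (M * (4 * R) ^ (7 / 4 : ℝ))) fun z hz ↦ hgn R hR1 z ?_
      · rw [iteratedDeriv_succ, iteratedDeriv_one] at h
        refine h.trans (le_of_eq ?_)
        have : R ^ (-(1 / 4) : ℝ) = R ^ (7 / 4 : ℝ) / R ^ 2 := by
          rw [← Real.rpow_two, ← Real.rpow_sub hR0]
          norm_num
        rw [this, Real.mul_rpow (by norm_num) hR0.le]
        norm_num [Nat.factorial]
        ring
      · rw [mem_sphere_iff_norm] at hz
        linarith [norm_sub_norm_le z c]
    have hlim : Tendsto (fun R : ℝ ↦ 4 * M * 4 ^ (7 / 4 : ℝ) * R ^ (-(1 / 4) : ℝ)) atTop (𝓝 0) := by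
      simpa using (tendsto_rpow_neg_atTop (y := 1 / 4) (by norm_num)).const_mul
        (4 * M * 4 ^ (7 / 4 : ℝ))
    exact norm_le_zero_iff.mp
      (ge_of_tendsto hlim ((eventually_ge_atTop (‖c‖ + 1)).mono fun R hR ↦ hb R hR))
  have hhalf : deriv F (1 / 2) = 0 := by
    have h1 : HasDerivAt F (deriv F (1 / 2)) (1 - 1 / 2) := by
      have := (hF (1 / 2)).hasDerivAt
      norm_num at this ⊢
      exact this
    have h2 := h1.comp_const_sub 1 (1 / 2)
    simp only [hsymm] at h2
    have h3 := h2.unique (hF (1 / 2)).hasDerivAt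
    linear_combination (-1 / 2) * h3
  have hdg z : deriv g z = 0 := by
    have := is_const_of_deriv_eq_zero hgd.deriv hd2 z (1 / 2)
    rw [this, (hg' _).deriv, hhalf, zero_div]
  rw [hexp, is_const_of_deriv_eq_zero hgd hdg s 0, hg0, exp_zero]

/-- An entire function of finite order which is bounded on a right half-plane and symmetric about
`1/2` is constant. -/
lemma eq_one_of_bounded_half_plane {F : ℂ → ℂ} (hF : Differentiable ℂ F) (h0 : F 0 = 1)
    (hsymm : ∀ s, F (1 - s) = F s) {K : ℝ}
    (hK : ∀ R : ℝ, 1 ≤ R → ∀ s : ℂ, ‖s‖ ≤ R → ‖F s‖ ≤ Real.exp (K * R ^ (7 / 4 : ℝ)))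
    {A C : ℝ} (hA : 1 ≤ A) (hC : ∀ s : ℂ, A ≤ s.re → ‖F s‖ ≤ C) (s : ℂ) : F s = 1 := by
  have hC' (s : ℂ) (hs : s.re ≤ 1 - A) : ‖F s‖ ≤ C := by
    rw [← hsymm]
    exact hC _ (by rw [sub_re, one_re]; linarith)
  have hbound (z : ℂ) : ‖F z‖ ≤ C := by
    rcases le_total A z.re with h | h
    · exact hC z h
    rcases le_total z.re (1 - A) with h' | h'
    · exact hC' z h'
    set c : ℝ := 1 / (A - (1 - A)) with hc
    have hc0 : 0 < c := by rw [hc]; apply one_div_pos.mpr; linarith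
    refine PhragmenLindelof.vertical_strip hF.diffContOnCl ⟨c, ?_, |K| * (2 * A ^ 2 + 4 / c ^ 2), ?_⟩
      (fun w hw ↦ hC' w hw.le) (fun w hw ↦ hC w hw.ge) h' h
    · rw [hc]
      exact div_lt_div_of_pos_right (by linarith [Real.pi_gt_three]) (by linarith)
    · refine Asymptotics.IsBigO.of_bound 1 ?_
      refine Filter.Eventually.filter_mono inf_le_right ?_
      rw [eventually_principal]
      rintro w ⟨hw1, hw2⟩
      rw [one_mul, Real.norm_of_nonneg (Real.exp_pos _).le]
      have hwn : ‖w‖ ≤ A + |w.im| := by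
        have := norm_le_abs_re_add_abs_im w
        have : |w.re| ≤ A := abs_le.mpr ⟨by linarith, hw2.le⟩
        linarith
      have hR : 1 ≤ A + |w.im| := by linarith [abs_nonneg w.im]
      refine (hK _ hR w hwn).trans (Real.exp_le_exp.mpr ?_)
      set t := |w.im| with ht
      have ht0 : 0 ≤ t := abs_nonneg _
      have h1 : (A + t) ^ (7 / 4 : ℝ) ≤ (A + t) ^ 2 := by
        rw [← Real.rpow_two]
        exact Real.rpow_le_rpow_of_exponent_le hR (by norm_num)
      have h2 := Real.quadratic_le_exp_of_nonneg (x := c * t) (by positivity)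
      have h3 : t ^ 2 ≤ 2 / c ^ 2 * Real.exp (c * t) := by
        rw [div_mul_eq_mul_div, le_div_iff₀ (by positivity)]
        nlinarith [mul_nonneg hc0.le ht0]
      have h4 : 1 ≤ Real.exp (c * t) := Real.one_le_exp (by positivity)
      calc K * (A + t) ^ (7 / 4 : ℝ) ≤ |K| * (A + t) ^ 2 := by
            gcongr
            exact le_abs_self K
        _ ≤ |K| * ((2 * A ^ 2 + 4 / c ^ 2) * Real.exp (c * t)) := by
            gcongr
            have h5 : 4 / c ^ 2 = 2 * (2 / c ^ 2) := by ring
            rw [h5]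
            nlinarith [sq_nonneg (A - t), mul_le_mul_of_nonneg_left h4 (sq_nonneg A)]
        _ = _ := by ring
  have hb : Bornology.IsBounded (Set.range F) :=
    isBounded_iff_forall_norm_le.mpr ⟨C, by rintro _ ⟨z, rfl⟩; exact hbound z⟩
  rw [hF.apply_eq_apply_of_bounded hb s 0, h0]

lemma norm_riemannZeta_sub_one_le {s : ℂ} (hs : 2 ≤ s.re) :
    ‖riemannZeta s - 1‖ ≤ 2 ^ (2 - s.re) * ∑' n : ℕ, 1 / ((n : ℝ) + 2) ^ 2 := by
  have hs1 : 1 < s.re := by linarith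
  have hsum : Summable fun n : ℕ ↦ 1 / ((n : ℂ) + 1) ^ s := by
    have := (summable_nat_add_iff 1).mpr (summable_one_div_nat_cpow.mpr hs1)
    simpa using this
  have hsum2 : Summable fun n : ℕ ↦ 1 / ((n : ℝ) + 2) ^ 2 := by
    have := (summable_nat_add_iff 2).mpr (Real.summable_one_div_nat_pow.mpr (one_lt_two))
    simpa using this
  rw [zeta_eq_tsum_one_div_nat_add_one_cpow hs1, hsum.tsum_eq_zero_add]
  simp only [Nat.cast_zero, zero_add, one_cpow, div_one, add_sub_cancel_left]
  rw [← tsum_mul_left]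
  refine tsum_of_norm_bounded (hsum2.mul_left _).hasSum fun n ↦ ?_
  have hn : (0 : ℝ) < (n : ℝ) + 2 := by positivity
  have h1 : (((n + 1 : ℕ) : ℂ) + 1) = (((n : ℝ) + 2 : ℝ) : ℂ) := by push_cast; ring
  rw [h1, norm_div, norm_one, norm_cpow_eq_rpow_re_of_pos hn, one_div, ← Real.rpow_neg hn.le]
  calc ((n : ℝ) + 2) ^ (-s.re) = ((n : ℝ) + 2) ^ (2 - s.re) * (1 / ((n : ℝ) + 2) ^ 2) := by
        rw [one_div, ← Real.rpow_two, ← Real.rpow_neg hn.le, ← Real.rpow_add hn]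
        ring_nf
    _ ≤ 2 ^ (2 - s.re) * (1 / ((n : ℝ) + 2) ^ 2) := by
        gcongr ?_ * _
        exact Real.rpow_le_rpow_of_nonpos two_pos (by linarith [(Nat.cast_nonneg n : (0 : ℝ) ≤ n)])
          (by linarith)

lemma tendsto_riemannZeta_comap_re_atTop :
    Tendsto riemannZeta (comap re atTop) (𝓝 1) := by
  rw [tendsto_iff_norm_sub_tendsto_zero]
  have hlim : Tendsto (fun s : ℂ ↦ (2 : ℝ) ^ (2 - s.re) * ∑' n : ℕ, 1 / ((n : ℝ) + 2) ^ 2)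
      (comap re atTop) (𝓝 0) := by
    have h1 : Tendsto (fun x : ℝ ↦ (2 : ℝ) ^ (2 - x)) atTop (𝓝 0) :=
      (tendsto_rpow_atBot_of_base_gt_one 2 one_lt_two).comp
        (tendsto_const_nhds.add_atBot tendsto_neg_atTop_atBot)
    have h2 := (h1.comp (tendsto_comap (f := re))).mul_const (∑' n : ℕ, 1 / ((n : ℝ) + 2) ^ 2)
    rwa [zero_mul] at h2
  refine squeeze_zero' (.of_forall fun _ ↦ norm_nonneg _) ?_ hlim
  filter_upwards [tendsto_comap.eventually (eventually_ge_atTop (2 : ℝ))] with s hs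
  exact norm_riemannZeta_sub_one_le hs

lemma hfun_one_sub (sν : ℕ → ℂ) (s : ℂ) : hfun sν (1 - s) = hfun sν s := by
  rw [hfun_eq, hfun_eq, symmProd_one_sub]

lemma riemannXi_eq_mul_riemannZeta_of_one_lt_re {s : ℂ} (hs : 1 < s.re) :
    s / 2 * (s - 1) * (Real.pi : ℂ) ^ (-s / 2) * Gamma (s / 2) ≠ 0 ∧
      riemannXi s =
        s / 2 * (s - 1) * (Real.pi : ℂ) ^ (-s / 2) * Gamma (s / 2) * riemannZeta s := by
  have h0 : s ≠ 0 := by rintro rfl; norm_num at hs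
  have h1 : s ≠ 1 := by rintro rfl; norm_num at hs
  have hG : Gammaℝ s ≠ 0 := Gammaℝ_ne_zero_of_re_pos (by linarith)
  have hmul : s / 2 * (s - 1) * (Real.pi : ℂ) ^ (-s / 2) * Gamma (s / 2) =
      s / 2 * (s - 1) * Gammaℝ s := by rw [Gammaℝ_def]; ring
  rw [hmul]
  exact ⟨by simp [h0, sub_ne_zero.mpr h1, hG], riemannXi_eq_mul_riemannZeta h0 h1 hG⟩

lemma etaFun_mul_eq_riemannZeta {sν : ℕ → ℂ} {F : ℂ → ℂ}
    (hξ : ∀ z, riemannXi z = hfun sν z * F z) {s : ℂ} (hs : 1 < s.re) :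
    etaFun sν s * F s = riemannZeta s := by
  obtain ⟨h1, h2⟩ := riemannXi_eq_mul_riemannZeta_of_one_lt_re hs
  rw [etaFun, div_mul_eq_mul_div, ← hξ, h2, mul_div_cancel_left₀ _ h1]

lemma re_eq_half_of_riemannXi_eq_zero
    (hRH : ∀ s : ℂ, riemannZeta s = 0 → 0 ≤ s.re → s.re ≤ 1 → s.re = 1 / 2) {z : ℂ}
    (hz : riemannXi z = 0) : z.re = 1 / 2 := by
  rcases lt_or_ge 0 z.re with h | h
  · have hζ := riemannZeta_eq_zero_of_riemannXi_eq_zero hz h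
    refine hRH z hζ h.le ?_
    by_contra! h1
    exact riemannZeta_ne_zero_of_one_le_re h1.le hζ
  · rw [← riemannXi_one_sub] at hz
    have hre : 1 ≤ (1 - z).re := by rw [sub_re, one_re]; linarith
    exact absurd (riemannZeta_eq_zero_of_riemannXi_eq_zero hz (by linarith))
      (riemannZeta_ne_zero_of_one_le_re hre)

lemma re_eq_half_of_hfun_eq_zero {sν : ℕ → ℂ} (henum : CriticalZeroEnumFor riemannZeta sν)
    {s : ℂ} (hs : hfun sν s = 0) : s.re = 1 / 2 := by
  rw [hfun_eq] at hs
  by_contra hre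
  have hsum := summable_norm_symmProd_term (summable_inv_norm_sq henum) s
  refine tprod_one_add_ne_zero_of_summable (fun ν ↦ ?_) hsum
    ((mul_eq_zero.mp hs).resolve_left (by norm_num))
  have := symmFinprod_ne_zero (fun ν ↦ (henum.1 ν).1) (S := {ν}) (s := s)
    (fun μ _ h ↦ hre (h ▸ (henum.1 μ).1))
    (fun μ _ h ↦ hre (by rw [h, sub_re, one_re, (henum.1 μ).1]; norm_num))
  simpa [symmFinprod] using this

/-- The Riemann Hypothesis is true iff `η(s) → 1` as `Re s → +∞` (uniformly in `Im s`). -/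
theorem riemannHypothesis_iff_eta_tendsto_one (sν : ℕ → ℂ)
    (henum : CriticalZeroEnumFor riemannZeta sν) :
    (∀ s : ℂ, riemannZeta s = 0 → 0 ≤ s.re → s.re ≤ 1 → s.re = 1 / 2) ↔
      Tendsto (etaFun sν) (comap Complex.re atTop) (𝓝 1) := by
  obtain ⟨F, hF, hξ, ⟨K, hK⟩, hFne⟩ := exists_hfun_mul_eq_riemannXi henum
  have hh0 : hfun sν 0 = 1 / 2 := by rw [hfun_eq, symmProd_zero, mul_one]
  have hhd : Differentiable ℂ (hfun sν) := by
    have := differentiable_symmProd (summable_inv_norm_sq henum)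
    rw [funext hfun_eq]
    fun_prop
  have hF0 : F 0 = 1 := by
    have := hξ 0
    rw [riemannXi_zero, hh0] at this
    linear_combination -2 * this
  have hsymm (s : ℂ) : F (1 - s) = F s := by
    refine eq_of_forall_mul_eq_mul hhd (x := 0) (by rw [hh0]; norm_num)
      (f := fun s ↦ F (1 - s)) (by have := hF.continuous; fun_prop) hF.continuous (fun z ↦ ?_) s
    rw [← hξ, ← hfun_one_sub, ← hξ, riemannXi_one_sub]
  constructor
  · intro hRH
    have hne (z : ℂ) : F z ≠ 0 := by
      intro hz
      have hξz : riemannXi z = 0 := by rw [hξ, hz, mul_zero]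
      have hre := re_eq_half_of_riemannXi_eq_zero hRH hξz
      rcases lt_trichotomy z.im 0 with h | h | h
      · refine hFne (1 - z) (by simpa using h) ?_ (by rw [hsymm, hz])
        rw [sub_re, one_re, hre]
        norm_num
      · refine riemannXi_half_ne_zero ?_
        rw [← hξz]
        congr 1
        apply Complex.ext
        · rw [hre]; norm_num
        · rw [h]; norm_num
      · exact hFne z h hre hz
    refine tendsto_riemannZeta_comap_re_atTop.congr' ?_
    filter_upwards [tendsto_comap.eventually (eventually_gt_atTop (1 : ℝ))] with s hs
    rw [← etaFun_mul_eq_riemannZeta hξ hs, eq_one_of_forall_ne_zero hF hne hF0 hsymm hK, mul_one]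
  · intro hη s hs hs0 _
    obtain ⟨A, hA⟩ : ∃ A : ℝ, ∀ s : ℂ, A ≤ s.re → dist (etaFun sν s) 1 < 1 / 2 := by
      have h := (Metric.tendsto_nhds.mp hη) (1 / 2) (by norm_num)
      rw [eventually_comap] at h
      obtain ⟨A, hA⟩ := eventually_atTop.mp h
      exact ⟨A, fun s hs ↦ hA _ hs s rfl⟩
    have hbound (s : ℂ) (hs : max A 2 ≤ s.re) : ‖F s‖ ≤ 4 := by
      have hs2 : 2 ≤ s.re := (le_max_right _ _).trans hs
      have h1 := hA s ((le_max_left _ _).trans hs)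
      have h2 := norm_riemannZeta_le_two hs2
      rw [← etaFun_mul_eq_riemannZeta hξ (by linarith), norm_mul] at h2
      have h3 := norm_sub_norm_le 1 (etaFun sν s)
      rw [← dist_eq_norm, dist_comm, norm_one] at h3
      nlinarith [norm_nonneg (F s)]
    have hF1 := eq_one_of_bounded_half_plane hF hF0 hsymm hK
      (one_le_two.trans (le_max_right A 2)) hbound s
    have hξs := riemannXi_eq_zero_of_riemannZeta_eq_zero hs hs0
    rw [hξ, hF1, mul_one] at hξs
    exact re_eq_half_of_hfun_eq_zero henum hξs
end

section
/- The bound (log 4)/π in the exceptional-set condition is best possible: for L(s) = 1 + 2·4^{−s} and f(s) = (1 + 1/(s(1 − s)))·L(s), both f and L satisfy the functional equation 2^s g(s) = 2^{1−s}·conj(g(1 − conj(s))), f is meromorphic of order at most 1 with f(s) → 1 as Re(s) → +∞, and taking G to be the zero set of f (with multiplicity) one has lim_{r→∞} n(r, G)/r = (log 4)/π and Z⁺(f) \ G = ∅ ⊆ Z⁺(L), yet f is not identically equal to L. -/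
open Complex Filter Topology

attribute [local instance] Classical.propDecidable

/-- The order of the zero of `f` at `z` (`0` if `f` does not vanish there). -/
noncomputable def zeroOrd (f : ℂ → ℂ) (z : ℂ) : ℕ :=
  if h : ∃ m : ℕ, ZeroOfOrder f z m then h.choose else 0

/-- `f` has a pole of exact order `m` at `z`. -/
def PoleOfOrder (f : ℂ → ℂ) (z : ℂ) (m : ℕ) : Prop :=
  ∃ g : ℂ → ℂ, AnalyticAt ℂ g z ∧ g z ≠ 0 ∧
    ∀ᶠ w in 𝓝[≠] z, f w = g w / (w - z) ^ m

/-- The order of the pole of `f` at `z` (`0` if there is no pole). -/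
noncomputable def poleOrd (f : ℂ → ℂ) (z : ℂ) : ℕ :=
  if h : ∃ m : ℕ, 0 < m ∧ PoleOfOrder f z m then h.choose else 0

/-- `n(t, f)`: number of poles of `f`, counted with multiplicity, in the disc `|z| ≤ t`. -/
noncomputable def poleCount (f : ℂ → ℂ) (t : ℝ) : ℕ :=
  ∑ᶠ z ∈ {z : ℂ | ‖z‖ ≤ t}, poleOrd f z

/-- The Nevanlinna counting function `N(r, f)` of the poles of `f`. -/
noncomputable def nevN (f : ℂ → ℂ) (r : ℝ) : ℝ :=
  (∫ t in (0:ℝ)..r, ((poleCount f t : ℝ) - (poleCount f 0 : ℝ)) / t) +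
    (poleCount f 0 : ℝ) * Real.log r

/-- The Nevanlinna proximity function `m(r, f)`. -/
noncomputable def nevm (f : ℂ → ℂ) (r : ℝ) : ℝ :=
  (2 * Real.pi)⁻¹ *
    ∫ θ in (0:ℝ)..(2 * Real.pi), Real.log (max 1 ‖f (r * Complex.exp (θ * Complex.I))‖)

/-- The Nevanlinna characteristic `T(r, f) = m(r, f) + N(r, f)`. -/
noncomputable def nevT (f : ℂ → ℂ) (r : ℝ) : ℝ := nevm f r + nevN f r

/-- `f` has order at most `1`: `T(r, f) = O(r^{1+ε})` for every `ε > 0`. -/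
def OrderLeOne (f : ℂ → ℂ) : Prop :=
  ∀ ε : ℝ, 0 < ε → ∃ C : ℝ, 0 < C ∧ ∀ r : ℝ, 1 ≤ r → nevT f r ≤ C * r ^ (1 + ε)

/-- Equality of meromorphic functions (equality of germs off each point). -/
def MeroEq (f g : ℂ → ℂ) : Prop := ∀ z : ℂ, f =ᶠ[𝓝[≠] z] g

/-- `L(s) = 1 + 2·4^{-s}` (principal branch). -/
noncomputable def Lfun (s : ℂ) : ℂ := 1 + 2 * Complex.exp (-s * Real.log 4)

/-- `f(s) = (1 + 1/(s(1-s)))·L(s)`. -/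
noncomputable def fex (s : ℂ) : ℂ := (1 + 1 / (s * (1 - s))) * Lfun s

/-- `2^s` (principal branch). -/
noncomputable def twoPow (s : ℂ) : ℂ := Complex.exp (s * Real.log 2)


section Orders

lemma ZeroOfOrder.meromorphicOrderAt_eq {f : ℂ → ℂ} {z : ℂ} {m : ℕ} (h : ZeroOfOrder f z m) :
    meromorphicOrderAt f z = (m : ℤ) := by
  obtain ⟨g, hg, hgz, hfg⟩ := h
  have hmer : MeromorphicAt f z := by
    have : MeromorphicAt (fun w => (w - z) ^ m * g w) z := by
      have : AnalyticAt ℂ (fun w => (w - z) ^ m * g w) z := by fun_prop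
      exact this.meromorphicAt
    exact this.congr (hfg.mono fun w hw => hw.symm)
  rw [meromorphicOrderAt_eq_int_iff hmer]
  exact ⟨g, hg, hgz, by simpa using hfg⟩

lemma PoleOfOrder.meromorphicAt {f : ℂ → ℂ} {z : ℂ} {m : ℕ} (h : PoleOfOrder f z m) :
    MeromorphicAt f z := by
  obtain ⟨g, hg, hgz, hfg⟩ := h
  have hd : AnalyticAt ℂ (fun w => (w - z) ^ m) z := by fun_prop
  exact (hg.meromorphicAt.div hd.meromorphicAt).congr (hfg.mono fun w hw => hw.symm)

lemma PoleOfOrder.meromorphicOrderAt_eq {f : ℂ → ℂ} {z : ℂ} {m : ℕ} (h : PoleOfOrder f z m) :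
    meromorphicOrderAt f z = (-m : ℤ) := by
  rw [meromorphicOrderAt_eq_int_iff h.meromorphicAt]
  obtain ⟨g, hg, hgz, hfg⟩ := h
  refine ⟨g, hg, hgz, hfg.mono fun w hw => ?_⟩
  rw [hw, zpow_neg, zpow_natCast, smul_eq_mul, div_eq_mul_inv, mul_comm]

lemma ZeroOfOrder.zeroOrd_eq {f : ℂ → ℂ} {z : ℂ} {m : ℕ} (h : ZeroOfOrder f z m) :
    zeroOrd f z = m := by
  have hex : ∃ m : ℕ, ZeroOfOrder f z m := ⟨m, h⟩
  have h1 := hex.choose_spec.meromorphicOrderAt_eq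
  rw [h.meromorphicOrderAt_eq] at h1
  rw [zeroOrd, dif_pos hex]
  exact_mod_cast h1.symm

lemma PoleOfOrder.poleOrd_eq {f : ℂ → ℂ} {z : ℂ} {m : ℕ} (hm : 0 < m) (h : PoleOfOrder f z m) :
    poleOrd f z = m := by
  have hex : ∃ m : ℕ, 0 < m ∧ PoleOfOrder f z m := ⟨m, hm, h⟩
  have h1 := hex.choose_spec.2.meromorphicOrderAt_eq
  rw [h.meromorphicOrderAt_eq] at h1
  rw [poleOrd, dif_pos hex]
  have h2 : (-(m : ℤ)) = -((hex.choose : ℕ) : ℤ) := by exact_mod_cast h1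
  omega

lemma PoleOfOrder.zeroOrd_eq_zero {f : ℂ → ℂ} {z : ℂ} {m : ℕ} (hm : 0 < m)
    (h : PoleOfOrder f z m) : zeroOrd f z = 0 := by
  rw [zeroOrd, dif_neg]
  rintro ⟨k, hk⟩
  have h1 := hk.meromorphicOrderAt_eq
  rw [h.meromorphicOrderAt_eq] at h1
  have h2 : (-(m : ℤ)) = (k : ℤ) := by exact_mod_cast h1
  omega

lemma AnalyticAt.poleOrd_eq_zero {f : ℂ → ℂ} {z : ℂ} (hf : AnalyticAt ℂ f z) :
    poleOrd f z = 0 := by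
  rw [poleOrd, dif_neg]
  rintro ⟨k, hk0, hk⟩
  have h1 := hk.meromorphicOrderAt_eq
  have h2 := hf.meromorphicOrderAt_nonneg
  rw [h1] at h2
  have h3 : (0 : ℤ) ≤ -(k : ℤ) := by exact_mod_cast h2
  omega

lemma AnalyticAt.zeroOrd_eq_zero {f : ℂ → ℂ} {z : ℂ} (hf : AnalyticAt ℂ f z) (hz : f z ≠ 0) :
    zeroOrd f z = 0 :=
  ZeroOfOrder.zeroOrd_eq ⟨f, hf, hz, by simp⟩

lemma AnalyticAt.zeroOrd_eq_one {f : ℂ → ℂ} {z : ℂ} (hf : AnalyticAt ℂ f z) (hz : f z = 0)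
    (hd : deriv f z ≠ 0) : zeroOrd f z = 1 := by
  have h1 := hf.analyticOrderAt_eq_one_of_zero_deriv_ne_zero hz hd
  have h2 : analyticOrderAt f z = ((1 : ℕ) : ℕ∞) := by simpa using h1
  rw [hf.analyticOrderAt_eq_natCast] at h2
  obtain ⟨g, hg, hgz, hfg⟩ := h2
  exact ZeroOfOrder.zeroOrd_eq ⟨g, hg, hgz, by simpa using hfg.filter_mono nhdsWithin_le_nhds⟩

end Orders

section Basic

lemma log_four_pos : 0 < Real.log 4 := Real.log_pos (by norm_num)

lemma log_four_eq : Real.log 4 = 2 * Real.log 2 := by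
  rw [show (4 : ℝ) = 2 ^ 2 by norm_num, Real.log_pow]; norm_num

lemma exp_ofReal_log {x : ℝ} (hx : 0 < x) : Complex.exp (Real.log x) = x := by
  rw [← Complex.ofReal_exp, Real.exp_log hx]

lemma analyticAt_Lfun (z : ℂ) : AnalyticAt ℂ Lfun z := by
  unfold Lfun; fun_prop

lemma twoPow_one_sub (s : ℂ) : twoPow (1 - s) = 2 * Complex.exp (-s * Real.log 2) := by
  rw [twoPow, show (1 - s) * (Real.log 2 : ℂ) = Real.log 2 + -s * Real.log 2 by ring,
    Complex.exp_add, exp_ofReal_log (by norm_num)]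
  norm_num

lemma conj_Lfun (s : ℂ) : (starRingEnd ℂ) (Lfun s) = Lfun ((starRingEnd ℂ) s) := by
  simp only [Lfun, map_add, map_one, map_mul, map_neg, ← Complex.exp_conj, Complex.conj_ofReal,
    map_ofNat]

lemma Lfun_functional (s : ℂ) : twoPow s * Lfun s =
    twoPow (1 - s) * (starRingEnd ℂ) (Lfun (1 - (starRingEnd ℂ) s)) := by
  have key : ∀ w, twoPow w * Lfun w = twoPow w + twoPow (1 - w) := by
    intro w
    rw [twoPow_one_sub, twoPow, Lfun, log_four_eq]
    have : Complex.exp (w * Real.log 2) * Complex.exp (-w * (2 * Real.log 2 : ℝ)) =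
        Complex.exp (-w * Real.log 2) := by
      rw [← Complex.exp_add]; congr 1; push_cast; ring
    linear_combination 2 * this
  rw [conj_Lfun]
  have : (starRingEnd ℂ) (1 - (starRingEnd ℂ) s) = 1 - s := by simp
  rw [this, key, key]
  ring_nf

lemma fex_functional (s : ℂ) : twoPow s * fex s =
    twoPow (1 - s) * (starRingEnd ℂ) (fex (1 - (starRingEnd ℂ) s)) := by
  have h := Lfun_functional s
  simp only [fex, map_mul, map_add, map_one, map_div₀, map_sub, Complex.conj_conj]
  linear_combination (1 + 1 / (s * (1 - s))) * h

lemma analyticAt_fex {z : ℂ} (h0 : z ≠ 0) (h1 : z ≠ 1) : AnalyticAt ℂ fex z := by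
  have h : z * (1 - z) ≠ 0 := mul_ne_zero h0 (sub_ne_zero.2 h1.symm)
  have hA : AnalyticAt ℂ (fun s : ℂ => 1 + 1 / (s * (1 - s))) z := by
    fun_prop (disch := exact h)
  exact hA.mul (analyticAt_Lfun z)

lemma Lfun_zero : Lfun 0 = 3 := by
  simp [Lfun]; norm_num

lemma Lfun_one : Lfun 1 = 3 / 2 := by
  rw [Lfun, neg_one_mul, Complex.exp_neg, exp_ofReal_log (by norm_num)]
  norm_num

lemma poleOfOrder_fex_zero : PoleOfOrder fex 0 1 := by
  have hA : AnalyticAt ℂ (fun s : ℂ => (1 + s - s ^ 2) / (1 - s)) 0 := by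
    fun_prop (disch := simp)
  refine ⟨fun s => (1 + s - s ^ 2) / (1 - s) * Lfun s, hA.mul (analyticAt_Lfun 0), ?_, ?_⟩
  · simp [Lfun_zero]
  · have : ∀ᶠ w : ℂ in 𝓝[≠] 0, w ≠ 1 :=
      (isOpen_ne.eventually_mem (by simp)).filter_mono nhdsWithin_le_nhds
    filter_upwards [this, self_mem_nhdsWithin] with w hw1 hw0
    have h1 : 1 - w ≠ 0 := sub_ne_zero.2 (Ne.symm hw1)
    have h0 : w ≠ 0 := hw0
    rw [fex]
    field_simp
    ring

lemma poleOfOrder_fex_one : PoleOfOrder fex 1 1 := by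
  have hA : AnalyticAt ℂ (fun s : ℂ => -(1 + s - s ^ 2) / s) 1 := by
    fun_prop (disch := simp)
  refine ⟨fun s => -(1 + s - s ^ 2) / s * Lfun s, hA.mul (analyticAt_Lfun 1), ?_, ?_⟩
  · simp [Lfun_one]
  · have : ∀ᶠ w : ℂ in 𝓝[≠] 1, w ≠ 0 :=
      (isOpen_ne.eventually_mem (by simp)).filter_mono nhdsWithin_le_nhds
    filter_upwards [this, self_mem_nhdsWithin] with w h0 hw1
    have h1 : 1 - w ≠ 0 := sub_ne_zero.2 (Ne.symm hw1)
    have h2 : w - 1 ≠ 0 := sub_ne_zero.2 hw1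
    rw [fex]
    field_simp
    ring

lemma meromorphicAt_fex (z : ℂ) : MeromorphicAt fex z := by
  by_cases h0 : z = 0
  · exact h0 ▸ poleOfOrder_fex_zero.meromorphicAt
  by_cases h1 : z = 1
  · exact h1 ▸ poleOfOrder_fex_one.meromorphicAt
  exact (analyticAt_fex h0 h1).meromorphicAt

lemma not_meroEq_fex_Lfun : ¬ MeroEq fex Lfun := by
  intro h
  have h1 := meromorphicOrderAt_congr (h 0)
  have h2 := (analyticAt_Lfun 0).meromorphicOrderAt_nonneg
  rw [← h1, poleOfOrder_fex_zero.meromorphicOrderAt_eq] at h2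
  have h3 : (0 : ℤ) ≤ -((1 : ℕ) : ℤ) := by exact_mod_cast h2
  omega

lemma tendsto_fex : Tendsto fex (comap Complex.re atTop) (𝓝 1) := by
  have hre : Tendsto Complex.re (comap Complex.re atTop) atTop := tendsto_comap
  have hL : Tendsto Lfun (comap Complex.re atTop) (𝓝 1) := by
    have hexp : Tendsto (fun s : ℂ => Complex.exp (-s * Real.log 4))
        (comap Complex.re atTop) (𝓝 0) := by
      rw [tendsto_zero_iff_norm_tendsto_zero]
      simp only [Complex.norm_exp]
      refine Real.tendsto_exp_atBot.comp ?_
      have : ∀ s : ℂ, (-s * (Real.log 4 : ℂ)).re = -(s.re * Real.log 4) := by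
        intro s; rw [Complex.re_mul_ofReal, Complex.neg_re, neg_mul]
      simp only [this]
      exact tendsto_neg_atTop_atBot.comp (hre.atTop_mul_const log_four_pos)
    have := (hexp.const_mul 2).const_add 1
    rw [mul_zero, add_zero] at this
    exact this
  have hA : Tendsto (fun s : ℂ => 1 + 1 / (s * (1 - s))) (comap Complex.re atTop) (𝓝 1) := by
    have h0 : Tendsto (fun s : ℂ => ‖s * (1 - s)‖) (comap Complex.re atTop) atTop := by
      refine tendsto_atTop_mono' _ ?_ hre
      filter_upwards [hre.eventually_ge_atTop 2] with s hs
      rw [norm_mul]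
      have h1 : s.re ≤ ‖s‖ := Complex.re_le_norm s
      have h2 : 1 ≤ ‖1 - s‖ := by
        have := Complex.abs_re_le_norm (1 - s)
        have h3 := neg_abs_le (1 - s).re
        simp only [Complex.sub_re, Complex.one_re] at this h3
        linarith
      nlinarith [norm_nonneg s]
    have h1 : Tendsto (fun s : ℂ => 1 / (s * (1 - s))) (comap Complex.re atTop) (𝓝 0) := by
      simp only [one_div]
      exact tendsto_inv₀_cobounded.comp (tendsto_norm_atTop_iff_cobounded.1 h0)
    simpa using h1.const_add 1
  have := hA.mul hL
  rw [mul_one] at this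
  exact this

end Basic

section Order

lemma poleOrd_fex (z : ℂ) : poleOrd fex z = if z = 0 ∨ z = 1 then 1 else 0 := by
  split_ifs with h
  · rcases h with rfl | rfl
    · exact poleOfOrder_fex_zero.poleOrd_eq one_pos
    · exact poleOfOrder_fex_one.poleOrd_eq one_pos
  · push Not at h
    exact (analyticAt_fex h.1 h.2).poleOrd_eq_zero

lemma poleCount_fex (t : ℝ) :
    poleCount fex t = (if 0 ≤ t then 1 else 0) + (if 1 ≤ t then 1 else 0) := by
  rw [poleCount, finsum_mem_def]
  have hsub : Function.support ({z : ℂ | ‖z‖ ≤ t}.indicator (poleOrd fex)) ⊆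
      (({0, 1} : Finset ℂ) : Set ℂ) := by
    intro z hz
    rw [Function.mem_support, Set.indicator_apply, poleOrd_fex] at hz
    by_contra h
    apply hz
    have : ¬ (z = 0 ∨ z = 1) := by simpa using h
    simp [this]
  rw [finsum_eq_sum_of_support_subset _ hsub, Finset.sum_pair zero_ne_one]
  simp [Set.indicator_apply, poleOrd_fex]

lemma nevN_fex_le {r : ℝ} (hr : 1 ≤ r) : nevN fex r ≤ 2 * r := by
  have h1 : ∀ t ∈ Set.uIoc 0 r,
      ‖((poleCount fex t : ℝ) - (poleCount fex 0 : ℝ)) / t‖ ≤ 1 := by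
    intro t ht
    rw [Set.uIoc_of_le (by linarith)] at ht
    have ht0 : 0 ≤ t := ht.1.le
    have h0 : ¬ ((1 : ℝ) ≤ 0) := by norm_num
    simp only [poleCount_fex, ht0, le_refl, if_true, h0, if_false]
    split_ifs with h
    · rw [Real.norm_eq_abs, abs_div, abs_of_pos ht.1, div_le_one ht.1]
      norm_num
      exact h
    · norm_num
  have h2 := intervalIntegral.norm_integral_le_of_norm_le_const h1
  rw [sub_zero, one_mul, abs_of_nonneg (by linarith : (0 : ℝ) ≤ r)] at h2
  have h3 := (le_abs_self _).trans h2
  have h4 : (poleCount fex 0 : ℝ) = 1 := by simp [poleCount_fex]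
  have h5 : Real.log r ≤ r := (Real.log_le_sub_one_of_pos (by linarith)).trans (by linarith)
  rw [nevN]
  rw [h4] at h3 ⊢
  linarith

lemma norm_Lfun_le (s : ℂ) : ‖Lfun s‖ ≤ 3 * Real.exp (‖s‖ * Real.log 4) := by
  have h1 : ‖Complex.exp (-s * Real.log 4)‖ ≤ Real.exp (‖s‖ * Real.log 4) := by
    rw [Complex.norm_exp, Complex.re_mul_ofReal, Complex.neg_re]
    gcongr
    exact (neg_le_abs _).trans (Complex.abs_re_le_norm s)
  have h2 : 1 ≤ Real.exp (‖s‖ * Real.log 4) :=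
    Real.one_le_exp (mul_nonneg (norm_nonneg _) log_four_pos.le)
  calc ‖Lfun s‖ ≤ ‖(1 : ℂ)‖ + ‖2 * Complex.exp (-s * Real.log 4)‖ := norm_add_le _ _
    _ ≤ 3 * Real.exp (‖s‖ * Real.log 4) := by
      rw [norm_mul]
      norm_num at h1 ⊢
      linarith

lemma abs_sin_le_norm_one_sub (r θ : ℝ) :
    |Real.sin θ| ≤ ‖1 - (r : ℂ) * Complex.exp (θ * Complex.I)‖ := by
  have h1 : ‖1 - (r : ℂ) * Complex.exp (θ * Complex.I)‖ =
      ‖Complex.exp ((-θ : ℝ) * Complex.I) - r‖ := by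
    have : Complex.exp ((-θ : ℝ) * Complex.I) - r =
        Complex.exp ((-θ : ℝ) * Complex.I) * (1 - (r : ℂ) * Complex.exp (θ * Complex.I)) := by
      have h : Complex.exp ((-θ : ℝ) * Complex.I) * Complex.exp (θ * Complex.I) = 1 := by
        rw [← Complex.exp_add]; simp
      linear_combination (r : ℂ) * h
    rw [this, norm_mul, Complex.norm_exp_ofReal_mul_I, one_mul]
  rw [h1]
  refine le_trans (le_of_eq ?_) (Complex.abs_im_le_norm _)
  rw [Complex.sub_im, Complex.exp_ofReal_mul_I_im, Complex.ofReal_im, sub_zero, Real.sin_neg,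
    abs_neg]

lemma log_max_one_norm_fex_le {r θ : ℝ} (hr : 1 ≤ r) (hθ : Real.sin θ ≠ 0) :
    Real.log (max 1 ‖fex (r * Complex.exp (θ * Complex.I))‖) ≤
      Real.log 6 + r * Real.log 4 - Real.log (Real.sin θ) := by
  set s : ℂ := r * Complex.exp (θ * Complex.I) with hs
  have hns : ‖s‖ = r := by
    rw [hs, norm_mul, Complex.norm_exp_ofReal_mul_I, mul_one, Complex.norm_real,
      Real.norm_of_nonneg (by linarith)]
  have hpos : 0 < |Real.sin θ| := abs_pos.2 hθ
  have h1 : |Real.sin θ| ≤ 1 := Real.abs_sin_le_one θ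
  have h2 : |Real.sin θ| ≤ ‖s * (1 - s)‖ := by
    rw [norm_mul, hns]
    have := abs_sin_le_norm_one_sub r θ
    nlinarith [norm_nonneg (1 - s)]
  have h3 : ‖1 + 1 / (s * (1 - s))‖ ≤ 2 / |Real.sin θ| := by
    calc ‖1 + 1 / (s * (1 - s))‖ ≤ ‖(1 : ℂ)‖ + ‖1 / (s * (1 - s))‖ := norm_add_le _ _
      _ = 1 + 1 / ‖s * (1 - s)‖ := by rw [norm_div, norm_one]
      _ ≤ 1 / |Real.sin θ| + 1 / |Real.sin θ| := by
        gcongr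
        rw [le_div_iff₀ hpos]; linarith
      _ = 2 / |Real.sin θ| := by ring
  have h4 := norm_Lfun_le s
  rw [hns] at h4
  have hE : 1 ≤ Real.exp (r * Real.log 4) :=
    Real.one_le_exp (mul_nonneg (by linarith) log_four_pos.le)
  have h5 : ‖fex s‖ ≤ 6 * Real.exp (r * Real.log 4) / |Real.sin θ| := by
    rw [fex, norm_mul]
    calc _ ≤ 2 / |Real.sin θ| * (3 * Real.exp (r * Real.log 4)) := by gcongr
      _ = _ := by ring
  have h6 : max 1 ‖fex s‖ ≤ 6 * Real.exp (r * Real.log 4) / |Real.sin θ| := by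
    refine max_le ?_ h5
    rw [le_div_iff₀ hpos]
    linarith
  calc Real.log (max 1 ‖fex s‖)
      ≤ Real.log (6 * Real.exp (r * Real.log 4) / |Real.sin θ|) :=
        Real.log_le_log (by positivity) h6
    _ = _ := by
      rw [Real.log_div (by positivity) hpos.ne', Real.log_mul (by norm_num) (by positivity),
        Real.log_exp, Real.log_abs]

lemma nevm_fex_le : ∃ C : ℝ, 0 ≤ C ∧ ∀ r : ℝ, 1 ≤ r → nevm fex r ≤ C * r := by
  set K : ℝ := ∫ θ in (0:ℝ)..(2 * Real.pi), Real.log (Real.sin θ) with hK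
  have hint : IntervalIntegrable (fun θ => Real.log (Real.sin θ)) MeasureTheory.volume
      0 (2 * Real.pi) := intervalIntegrable_log_sin
  have h2pi : (0 : ℝ) < 2 * Real.pi := by positivity
  have hl4 := log_four_pos
  have hl6 : 0 < Real.log 6 := Real.log_pos (by norm_num)
  refine ⟨Real.log 6 + Real.log 4 + (2 * Real.pi)⁻¹ * |K|, by positivity, fun r hr => ?_⟩
  have hae : ∀ᵐ θ : ℝ, Real.sin θ ≠ 0 := by
    have hc : {θ : ℝ | Real.sin θ = 0}.Countable := by
      refine (Set.countable_range fun n : ℤ => (n : ℝ) * Real.pi).mono ?_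
      intro θ hθ
      exact Real.sin_eq_zero_iff.1 hθ
    have := hc.ae_notMem MeasureTheory.volume
    simpa using this
  have hg : IntervalIntegrable
      (fun θ => Real.log 6 + r * Real.log 4 - Real.log (Real.sin θ)) MeasureTheory.volume
      0 (2 * Real.pi) := intervalIntegrable_const.sub hint
  have hle : (∫ θ in (0:ℝ)..(2 * Real.pi),
        Real.log (max 1 ‖fex (r * Complex.exp (θ * Complex.I))‖)) ≤
      ∫ θ in (0:ℝ)..(2 * Real.pi), (Real.log 6 + r * Real.log 4 - Real.log (Real.sin θ)) := by
    rw [intervalIntegral.integral_of_le h2pi.le, intervalIntegral.integral_of_le h2pi.le]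
    refine MeasureTheory.integral_mono_of_nonneg ?_ hg.1 ?_
    · exact Eventually.of_forall fun θ => Real.log_nonneg (le_max_left _ _)
    · filter_upwards [MeasureTheory.ae_restrict_of_ae hae] with θ hθ
      exact log_max_one_norm_fex_le hr hθ
  rw [intervalIntegral.integral_sub intervalIntegrable_const hint,
    intervalIntegral.integral_const, ← hK, smul_eq_mul, sub_zero] at hle
  rw [nevm]
  calc _ ≤ (2 * Real.pi)⁻¹ * (2 * Real.pi * (Real.log 6 + r * Real.log 4) - K) := by gcongr
    _ = Real.log 6 + r * Real.log 4 + (2 * Real.pi)⁻¹ * (-K) := by field_simp; ring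
    _ ≤ Real.log 6 * r + r * Real.log 4 + (2 * Real.pi)⁻¹ * (|K| * r) := by
      gcongr
      · nlinarith
      · nlinarith [neg_le_abs K, abs_nonneg K]
    _ = _ := by ring

lemma orderLeOne_fex : OrderLeOne fex := by
  obtain ⟨C, hC, h⟩ := nevm_fex_le
  intro ε hε
  refine ⟨C + 2, by linarith, fun r hr => ?_⟩
  have h1 := h r hr
  have h2 := nevN_fex_le hr
  have h3 : r ≤ r ^ (1 + ε) := Real.self_le_rpow_of_one_le hr (by linarith)
  rw [nevT]
  nlinarith

end Order

section Zeros

/-- The zeros `1/2 + (2k+1)πi/log 4` of `Lfun`. -/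
noncomputable def LfunZero (k : ℤ) : ℂ := ⟨1 / 2, (2 * k + 1) * (Real.pi / Real.log 4)⟩

lemma Lfun_eq_zero_iff (z : ℂ) : Lfun z = 0 ↔ ∃ k : ℤ, z = LfunZero k := by
  have hl : (Real.log 4 : ℂ) ≠ 0 := by exact_mod_cast log_four_pos.ne'
  have hl2 : (Real.log 4 : ℂ) = 2 * Real.log 2 := by exact_mod_cast log_four_eq
  have h1 : Complex.exp (-Real.log 2 + Real.pi * Complex.I) = -1 / 2 := by
    rw [Complex.exp_add, Complex.exp_pi_mul_I, Complex.exp_neg, exp_ofReal_log (by norm_num)]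
    norm_num
  have hz : ∀ k : ℤ, LfunZero k =
      1 / 2 + (2 * k + 1) * (Real.pi / Real.log 4) * Complex.I := by
    intro k
    rw [LfunZero, Complex.mk_eq_add_mul_I]
    push_cast
    rfl
  have h2 : Lfun z = 0 ↔
      Complex.exp (-z * Real.log 4) = Complex.exp (-Real.log 2 + Real.pi * Complex.I) := by
    rw [h1, Lfun]
    constructor <;> intro h
    · linear_combination h / 2
    · linear_combination 2 * h
  rw [h2, Complex.exp_eq_exp_iff_exists_int]
  constructor
  · rintro ⟨n, hn⟩
    refine ⟨-n - 1, ?_⟩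
    rw [hz]
    apply mul_right_cancel₀ hl
    push_cast
    field_simp
    linear_combination -2 * hn - hl2
  · rintro ⟨k, rfl⟩
    refine ⟨-k - 1, ?_⟩
    rw [hz]
    push_cast
    field_simp
    linear_combination -hl2

lemma LfunZero_injective : Function.Injective LfunZero := by
  intro a b h
  have h1 := congrArg Complex.im h
  have hc : Real.pi / Real.log 4 ≠ 0 := (div_pos Real.pi_pos log_four_pos).ne'
  have h2 := mul_right_cancel₀ hc h1
  have h3 : (a : ℝ) = b := by linarith
  exact_mod_cast h3

lemma hasDerivAt_Lfun (z : ℂ) : HasDerivAt Lfun (-Real.log 4 * (Lfun z - 1)) z := by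
  have h := (((hasDerivAt_id z).neg.mul_const (Real.log 4 : ℂ)).cexp.const_mul 2).const_add 1
  refine h.congr_deriv ?_
  simp only [Lfun, Pi.neg_apply, id]
  ring

lemma hasDerivAt_factor {z : ℂ} (h0 : z ≠ 0) (h1 : z ≠ 1) :
    HasDerivAt (fun s : ℂ => 1 + 1 / (s * (1 - s))) (-(1 - 2 * z) / (z * (1 - z)) ^ 2) z := by
  have h : z * (1 - z) ≠ 0 := mul_ne_zero h0 (sub_ne_zero.2 h1.symm)
  have hp : HasDerivAt (fun s : ℂ => s * (1 - s)) (1 - 2 * z) z := by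
    refine ((hasDerivAt_id z).mul ((hasDerivAt_id z).const_sub 1)).congr_deriv ?_
    simp only [id]
    ring
  simp only [one_div]
  exact (hp.inv h).const_add 1

/-- The zeros of `s ↦ 1 + 1/(s(1-s))`. -/
noncomputable def factorZeros : Finset ℂ :=
  {((Real.goldenRatio : ℝ) : ℂ), ((Real.goldenConj : ℝ) : ℂ)}

lemma card_factorZeros : factorZeros.card = 2 := by
  apply Finset.card_pair
  intro h
  have h1 : Real.goldenRatio = Real.goldenConj := by exact_mod_cast h
  linarith [Real.goldenRatio_pos, Real.goldenConj_neg]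

lemma mem_factorZeros_iff {z : ℂ} : z ∈ factorZeros ↔ 1 + z - z ^ 2 = 0 := by
  have hs : (Real.goldenRatio : ℂ) + Real.goldenConj = 1 := by
    exact_mod_cast Real.goldenRatio_add_goldenConj
  have hp : (Real.goldenRatio : ℂ) * Real.goldenConj = -1 := by
    exact_mod_cast Real.goldenRatio_mul_goldenConj
  have : 1 + z - z ^ 2 = -((z - Real.goldenRatio) * (z - Real.goldenConj)) := by
    linear_combination -z * hs + hp
  rw [this, neg_eq_zero, mul_eq_zero, sub_eq_zero, sub_eq_zero]
  simp [factorZeros]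

lemma factor_eq {z : ℂ} (h0 : z ≠ 0) (h1 : z ≠ 1) :
    1 + 1 / (z * (1 - z)) = (1 + z - z ^ 2) / (z * (1 - z)) := by
  have h1' : 1 - z ≠ 0 := sub_ne_zero.2 h1.symm
  field_simp
  ring

lemma norm_lt_two_of_mem_factorZeros {z : ℂ} (hz : z ∈ factorZeros) : ‖z‖ < 2 := by
  have hs := Real.goldenRatio_add_goldenConj
  have h3 := Real.goldenRatio_lt_two
  have h4 := Real.one_lt_goldenRatio
  simp only [factorZeros, Finset.mem_insert, Finset.mem_singleton] at hz
  rcases hz with rfl | rfl <;> rw [Complex.norm_real, Real.norm_eq_abs, abs_lt] <;>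
    constructor <;> linarith

lemma LfunZero_notMem_factorZeros (k : ℤ) : LfunZero k ∉ factorZeros := by
  intro h
  have hs := Real.goldenRatio_add_goldenConj
  have h4 := Real.one_lt_goldenRatio
  simp only [factorZeros, Finset.mem_insert, Finset.mem_singleton] at h
  rcases h with h | h <;> have h5 := congrArg Complex.re h <;>
    rw [Complex.ofReal_re] at h5 <;> simp only [LfunZero] at h5 <;> linarith

lemma LfunZero_ne (k : ℤ) : LfunZero k ≠ 0 ∧ LfunZero k ≠ 1 := by
  constructor <;> intro h <;> have := congrArg Complex.re h <;> norm_num [LfunZero] at this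

/-- The zero set of `fex`. -/
def fexZeros : Set ℂ := Set.range LfunZero ∪ factorZeros

lemma zeroOrd_fex (z : ℂ) : zeroOrd fex z = if z ∈ fexZeros then 1 else 0 := by
  by_cases h0 : z = 0
  · subst h0
    rw [poleOfOrder_fex_zero.zeroOrd_eq_zero one_pos, if_neg]
    rintro (⟨k, hk⟩ | h)
    · exact (LfunZero_ne k).1 hk
    · simpa using mem_factorZeros_iff.1 h
  by_cases h1 : z = 1
  · subst h1
    rw [poleOfOrder_fex_one.zeroOrd_eq_zero one_pos, if_neg]
    rintro (⟨k, hk⟩ | h)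
    · exact (LfunZero_ne k).2 hk
    · simpa using mem_factorZeros_iff.1 h
  have hp : z * (1 - z) ≠ 0 := mul_ne_zero h0 (sub_ne_zero.2 (Ne.symm h1))
  have ha := analyticAt_fex h0 h1
  have hd := ((hasDerivAt_factor h0 h1).mul (hasDerivAt_Lfun z)).deriv
  change deriv fex z = _ at hd
  have hf : fex z = (1 + z - z ^ 2) / (z * (1 - z)) * Lfun z := by rw [fex, factor_eq h0 h1]
  rw [factor_eq h0 h1] at hd
  split_ifs with h
  · rcases h with ⟨k, hk⟩ | h
    · have hL : Lfun z = 0 := (Lfun_eq_zero_iff z).2 ⟨k, hk.symm⟩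
      have hq : 1 + z - z ^ 2 ≠ 0 := fun h =>
        LfunZero_notMem_factorZeros k (hk ▸ mem_factorZeros_iff.2 h)
      have hl : (Real.log 4 : ℂ) ≠ 0 := by exact_mod_cast log_four_pos.ne'
      refine ha.zeroOrd_eq_one (by rw [hf, hL, mul_zero]) ?_
      rw [hd, hL, mul_zero, zero_add]
      exact mul_ne_zero (div_ne_zero hq hp) (mul_ne_zero (neg_ne_zero.2 hl) (by norm_num))
    · have hq := mem_factorZeros_iff.1 h
      have hL : Lfun z ≠ 0 := by
        intro hL
        obtain ⟨k, rfl⟩ := (Lfun_eq_zero_iff z).1 hL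
        exact LfunZero_notMem_factorZeros k h
      refine ha.zeroOrd_eq_one (by rw [hf, hq, zero_div, zero_mul]) ?_
      rw [hd, hq, zero_div, zero_mul, add_zero]
      refine mul_ne_zero (div_ne_zero (neg_ne_zero.2 fun h2 => ?_) (pow_ne_zero 2 hp)) hL
      have h3 : (5 : ℂ) = 0 := by linear_combination 4 * hq - (1 - 2 * z) * (-1) * h2
      norm_num at h3
  · refine ha.zeroOrd_eq_zero ?_
    rw [hf]
    refine mul_ne_zero (div_ne_zero (fun hq => h (Or.inr (mem_factorZeros_iff.2 hq))) hp) ?_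
    intro hL
    obtain ⟨k, rfl⟩ := (Lfun_eq_zero_iff z).1 hL
    exact h (Or.inl ⟨k, rfl⟩)

lemma abs_le_norm_LfunZero (k : ℤ) :
    |2 * (k : ℝ) + 1| * (Real.pi / Real.log 4) ≤ ‖LfunZero k‖ := by
  have hc : 0 < Real.pi / Real.log 4 := div_pos Real.pi_pos log_four_pos
  have h := Complex.abs_im_le_norm (LfunZero k)
  rwa [LfunZero, abs_mul, abs_of_pos hc] at h

lemma norm_LfunZero_le (k : ℤ) :
    ‖LfunZero k‖ ≤ 1 / 2 + |2 * (k : ℝ) + 1| * (Real.pi / Real.log 4) := by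
  have hc : 0 < Real.pi / Real.log 4 := div_pos Real.pi_pos log_four_pos
  have h := Complex.norm_le_abs_re_add_abs_im (LfunZero k)
  have hre : |(LfunZero k).re| = 1 / 2 := abs_of_pos (by norm_num [LfunZero])
  have him : |(LfunZero k).im| = |2 * (k : ℝ) + 1| * (Real.pi / Real.log 4) := by
    rw [LfunZero, abs_mul, abs_of_pos hc]
  rwa [hre, him] at h

lemma mem_Icc_iff_abs_le (M : ℝ) (k : ℤ) :
    k ∈ Finset.Icc ⌈(-M - 1) / 2⌉ ⌊(M - 1) / 2⌋ ↔ |2 * (k : ℝ) + 1| ≤ M := by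
  rw [Finset.mem_Icc, Int.ceil_le, Int.le_floor, abs_le]
  constructor <;> rintro ⟨h1, h2⟩ <;> constructor <;> linarith

lemma card_Icc_bounds {M : ℝ} (hM : 0 ≤ M) :
    M - 1 ≤ ((Finset.Icc ⌈(-M - 1) / 2⌉ ⌊(M - 1) / 2⌋).card : ℝ) ∧
      ((Finset.Icc ⌈(-M - 1) / 2⌉ ⌊(M - 1) / 2⌋).card : ℝ) ≤ M + 1 := by
  rw [Int.card_Icc]
  have h1 := Int.ceil_lt_add_one ((-M - 1) / 2)
  have h2 := Int.le_ceil ((-M - 1) / 2)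
  have h3 := Int.lt_floor_add_one ((M - 1) / 2)
  have h4 := Int.floor_le ((M - 1) / 2)
  have h5 : (((⌊(M - 1) / 2⌋ + 1 - ⌈(-M - 1) / 2⌉).toNat : ℤ) : ℝ) =
      ((max (⌊(M - 1) / 2⌋ + 1 - ⌈(-M - 1) / 2⌉) 0 : ℤ) : ℝ) := by
    rw [Int.ofNat_toNat]
  rw [Int.cast_natCast] at h5
  rw [h5]
  push_cast
  constructor
  · refine le_max_of_le_left ?_
    linarith
  · exact max_le (by linarith) (by linarith)

lemma finite_LfunZero_ball (r : ℝ) : {k : ℤ | ‖LfunZero k‖ ≤ r}.Finite := by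
  have hc : 0 < Real.pi / Real.log 4 := div_pos Real.pi_pos log_four_pos
  refine (Finset.finite_toSet (Finset.Icc ⌈(-(r / (Real.pi / Real.log 4)) - 1) / 2⌉
    ⌊(r / (Real.pi / Real.log 4) - 1) / 2⌋)).subset fun k hk => ?_
  rw [Finset.mem_coe, mem_Icc_iff_abs_le, le_div_iff₀ hc]
  exact (abs_le_norm_LfunZero k).trans hk

lemma finite_fexZeros_ball (r : ℝ) : (fexZeros ∩ {z : ℂ | ‖z‖ ≤ r}).Finite := by
  refine (((finite_LfunZero_ball r).image LfunZero).union factorZeros.finite_toSet).subset ?_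
  rintro z ⟨⟨k, rfl⟩ | h, hz⟩
  · exact Or.inl ⟨k, hz, rfl⟩
  · exact Or.inr h

lemma finsum_zeroOrd_fex {r : ℝ} (hr : 2 ≤ r) :
    ∑ᶠ z ∈ {z : ℂ | ‖z‖ ≤ r}, zeroOrd fex z = {k : ℤ | ‖LfunZero k‖ ≤ r}.ncard + 2 := by
  have h1 : ∑ᶠ z ∈ {z : ℂ | ‖z‖ ≤ r}, zeroOrd fex z =
      ∑ᶠ z ∈ fexZeros ∩ {z : ℂ | ‖z‖ ≤ r}, 1 := by
    apply finsum_congr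
    intro z
    rw [zeroOrd_fex, finsum_eq_if, finsum_eq_if]
    simp only [Set.mem_inter_iff]
    split_ifs <;> tauto
  have h2 : fexZeros ∩ {z : ℂ | ‖z‖ ≤ r} =
      LfunZero '' {k : ℤ | ‖LfunZero k‖ ≤ r} ∪ factorZeros := by
    ext z
    constructor
    · rintro ⟨⟨k, rfl⟩ | h, hz⟩
      · exact Or.inl ⟨k, hz, rfl⟩
      · exact Or.inr h
    · rintro (⟨k, hk, rfl⟩ | h)
      · exact ⟨Or.inl ⟨k, rfl⟩, hk⟩
      · exact ⟨Or.inr h, (norm_lt_two_of_mem_factorZeros h).le.trans hr⟩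
  rw [h1, finsum_one, h2, Set.ncard_union_eq ?_ ((finite_LfunZero_ball r).image _)
    factorZeros.finite_toSet, Set.ncard_image_of_injective _ LfunZero_injective,
    Set.ncard_coe_finset, card_factorZeros]
  rw [Set.disjoint_left]
  rintro _ ⟨k, -, rfl⟩
  exact LfunZero_notMem_factorZeros k

lemma ncard_LfunZero_bounds {r : ℝ} (hr : 2 ≤ r) :
    (r - 1 / 2) * (Real.log 4 / Real.pi) - 1 ≤ ({k : ℤ | ‖LfunZero k‖ ≤ r}.ncard : ℝ) ∧
      ({k : ℤ | ‖LfunZero k‖ ≤ r}.ncard : ℝ) ≤ r * (Real.log 4 / Real.pi) + 1 := by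
  have hc : 0 < Real.pi / Real.log 4 := div_pos Real.pi_pos log_four_pos
  have hd : ∀ x : ℝ, x * (Real.log 4 / Real.pi) = x / (Real.pi / Real.log 4) := by
    intro x; rw [div_div_eq_mul_div, mul_div_assoc]
  rw [hd, hd]
  constructor
  · refine (card_Icc_bounds (div_nonneg (by linarith) hc.le)).1.trans ?_
    rw [← Set.ncard_coe_finset]
    refine Nat.cast_le.2 (Set.ncard_le_ncard (fun k hk => ?_) (finite_LfunZero_ball r))
    rw [Finset.mem_coe, mem_Icc_iff_abs_le, le_div_iff₀ hc] at hk
    exact (norm_LfunZero_le k).trans (by linarith)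
  · refine le_trans ?_ (card_Icc_bounds (div_nonneg (by linarith) hc.le)).2
    rw [← Set.ncard_coe_finset]
    refine Nat.cast_le.2 (Set.ncard_le_ncard (fun k hk => ?_) (Finset.finite_toSet _))
    rw [Finset.mem_coe, mem_Icc_iff_abs_le, le_div_iff₀ hc]
    exact (abs_le_norm_LfunZero k).trans hk

lemma tendsto_zeroCount_fex :
    Tendsto (fun r : ℝ => ((∑ᶠ z ∈ {z : ℂ | ‖z‖ ≤ r}, zeroOrd fex z : ℕ) : ℝ) / r)
      atTop (𝓝 (Real.log 4 / Real.pi)) := by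
  have hlim : ∀ a : ℝ, Tendsto (fun r : ℝ => Real.log 4 / Real.pi + a / r) atTop
      (𝓝 (Real.log 4 / Real.pi)) := by
    intro a
    simpa using (tendsto_const_nhds (x := a)).div_atTop tendsto_id |>.const_add
      (Real.log 4 / Real.pi)
  refine tendsto_of_tendsto_of_tendsto_of_le_of_le'
    (hlim (1 - 1 / 2 * (Real.log 4 / Real.pi))) (hlim 3) ?_ ?_
  · filter_upwards [eventually_ge_atTop 2] with r hr
    have hcount := finsum_zeroOrd_fex hr
    simp only [Set.mem_ofPred_eq] at hcount ⊢
    rw [hcount, le_div_iff₀ (by linarith), add_mul,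
      div_mul_cancel₀ _ (by linarith : r ≠ 0)]
    push_cast
    linarith [(ncard_LfunZero_bounds hr).1]
  · filter_upwards [eventually_ge_atTop 2] with r hr
    have hcount := finsum_zeroOrd_fex hr
    simp only [Set.mem_ofPred_eq] at hcount ⊢
    rw [hcount, div_le_iff₀ (by linarith), add_mul,
      div_mul_cancel₀ _ (by linarith : r ≠ 0)]
    push_cast
    linarith [(ncard_LfunZero_bounds hr).2]

end Zeros

/-- Sharpness of the bound `(log 4)/π`: `L(s) = 1 + 2·4^{-s}` and
`f(s) = (1 + 1/(s(1-s)))·L(s)` satisfy the same functional equation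
`2^s g(s) = 2^{1-s} conj (g(1 - conj s))`, `f` is meromorphic of order at most `1` with
`f(s) → 1` as `Re s → +∞`, and taking `G` to be the zero multiset of `f` one has
`n(r, G)/r → (log 4)/π` and `Z⁺(f) \ G = ∅ ⊆ Z⁺(L)`, yet `f ≢ L`. -/
theorem log_four_div_pi_best_possible :
    (∀ s : ℂ, twoPow s * Lfun s =
      twoPow (1 - s) * (starRingEnd ℂ) (Lfun (1 - (starRingEnd ℂ) s))) ∧
    (∀ s : ℂ, s ≠ 0 → s ≠ 1 → twoPow s * fex s =
      twoPow (1 - s) * (starRingEnd ℂ) (fex (1 - (starRingEnd ℂ) s))) ∧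
    (∀ z : ℂ, MeromorphicAt fex z) ∧
    OrderLeOne fex ∧
    Tendsto fex (comap Complex.re atTop) (𝓝 1) ∧
    (∀ r : ℝ, {z : ℂ | zeroOrd fex z ≠ 0 ∧ ‖z‖ ≤ r}.Finite) ∧
    Tendsto (fun r : ℝ => ((∑ᶠ z ∈ {z : ℂ | ‖z‖ ≤ r}, zeroOrd fex z : ℕ) : ℝ) / r)
      atTop (𝓝 (Real.log 4 / Real.pi)) ∧
    (∀ (z : ℂ) (m : ℕ), ZeroOfOrder fex z m → m ≤ zeroOrd fex z) ∧
    ¬ MeroEq fex Lfun := by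

  refine ⟨Lfun_functional, fun s _ _ => fex_functional s, meromorphicAt_fex, orderLeOne_fex,
    tendsto_fex, fun r => ?_, tendsto_zeroCount_fex, fun z m h => h.zeroOrd_eq.ge,
    not_meroEq_fex_Lfun⟩
  refine (finite_fexZeros_ball r).subset fun z hz => ⟨?_, hz.2⟩
  have h := hz.1
  rw [zeroOrd_fex] at h
  by_contra hn
  exact h (if_neg hn)
end
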